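/- arXiv:1307.6496 — 2 statements merged into one kernel-verified Lean document; each statement's English description precedes it below -/
import Mathlib

section
/- Let A be a finite dimensional hereditary K-algebra and T a finitely generated tilting A-module. Then there is a short exact sequence 0 → A → T₁ → T₂ → 0 with T₁, T₂ in add T and Hom_A(T₂, T₁) = 0. -/
noncomputable section
open Function

/-- `X` lies in `add T`: `X` is a direct summand of a finite direct sum of copies
of `T`. -/
def InAdd (A : Type) [Ring A] (T : Type) [AddCommGroup T] [Module A T]
    (X : ModuleCat.{0} A) : Prop :=
  ∃ (n : ℕ) (Y : ModuleCat.{0} A), Nonempty ((↑X × ↑Y) ≃ₗ[A] (Fin n → T))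

/-- `T` has projective dimension at most one. -/
def ProjDimLEOne (A : Type) [Ring A] (T : Type) [AddCommGroup T] [Module A T] : Prop :=
  ∃ (P : ModuleCat.{0} A) (p : ↑P →ₗ[A] T), Module.Projective A P ∧ Surjective p ∧
    Module.Projective A ↥(LinearMap.ker p)

/-- `Ext¹_A(T, N) = 0`: every short exact sequence `0 → N → Y → T → 0` splits. -/
def Ext1Vanish (A : Type) [Ring A] (T : Type) [AddCommGroup T] [Module A T]
    (N : Type) [AddCommGroup N] [Module A N] : Prop :=
  ∀ (Y : ModuleCat.{0} A) (j : N →ₗ[A] ↑Y) (g : ↑Y →ₗ[A] T),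
    Injective j → Surjective g → LinearMap.range j = LinearMap.ker g →
    ∃ s : T →ₗ[A] ↑Y, g.comp s = LinearMap.id

section helpers

variable {A : Type} [Ring A]

/-- Vanishing of Ext yields extension of maps along the injection. -/
lemma ext_extend {X N M Y : Type} [AddCommGroup X] [Module A X] [AddCommGroup N] [Module A N]
    [AddCommGroup M] [Module A M] [AddCommGroup Y] [Module A Y]
    (h : Ext1Vanish A X N) (j : M →ₗ[A] Y) (g : Y →ₗ[A] X)
    (hj : Injective j) (hg : Surjective g) (hjg : LinearMap.range j = LinearMap.ker g)
    (α : M →ₗ[A] N) : ∃ β : Y →ₗ[A] N, ∀ m, β (j m) = α m := by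
  let S : Submodule A (N × Y) := LinearMap.range (α.prod (-j))
  have hgj : ∀ m, g (j m) = 0 := fun m => by
    have : j m ∈ LinearMap.ker g := hjg ▸ ⟨m, rfl⟩
    exact this
  have hS : S ≤ LinearMap.ker (g ∘ₗ LinearMap.snd A N Y) := by
    rintro _ ⟨m, rfl⟩
    simp [hgj]
  let jN : N →ₗ[A] (N × Y) ⧸ S := S.mkQ ∘ₗ LinearMap.inl A N Y
  let gX : ((N × Y) ⧸ S) →ₗ[A] X := S.liftQ (g ∘ₗ LinearMap.snd A N Y) hS
  have h1 : Injective jN := by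
    rw [← LinearMap.ker_eq_bot, LinearMap.ker_eq_bot']
    intro n hn
    have : ((n, 0) : N × Y) ∈ S := by simpa [jN] using hn
    obtain ⟨m, hm⟩ := this
    simp only [LinearMap.prod_apply, Function.prod_apply, LinearMap.neg_apply, Prod.mk.injEq, neg_eq_zero] at hm
    have : m = 0 := hj (by simpa using hm.2)
    rw [← hm.1, this, map_zero]
  have h2 : Surjective gX := by
    intro x
    obtain ⟨y, rfl⟩ := hg x
    exact ⟨S.mkQ (0, y), by simp [gX]⟩
  have h3 : LinearMap.range jN = LinearMap.ker gX := by
    apply le_antisymm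
    · rintro _ ⟨n, rfl⟩
      simp [jN, gX]
    · intro z hz
      obtain ⟨⟨n, y⟩, rfl⟩ := S.mkQ_surjective z
      have hy : g y = 0 := by simpa [gX] using hz
      have hy' : y ∈ LinearMap.range j := by rw [hjg]; exact hy
      obtain ⟨m, rfl⟩ := hy'
      refine ⟨n + α m, ?_⟩
      simp only [jN, LinearMap.comp_apply]
      rw [← sub_eq_zero, ← map_sub]
      change S.mkQ _ = 0
      rw [Submodule.mkQ_apply, Submodule.Quotient.mk_eq_zero]
      exact ⟨m, by simp⟩
  obtain ⟨s, hs⟩ := h (ModuleCat.of A ((N × Y) ⧸ S)) jN gX h1 h2 h3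
  have hex : Function.Exact jN gX := LinearMap.exact_iff.2 h3.symm
  obtain ⟨-, l, hl⟩ := (hex.split_tfae'.out 0 1 rfl rfl).1 ⟨h1, s, hs⟩
  refine ⟨l ∘ₗ S.mkQ ∘ₗ LinearMap.inr A N Y, fun m => ?_⟩
  have e : S.mkQ (0, j m) = S.mkQ (α m, 0) := by
    rw [← sub_eq_zero, ← map_sub, Submodule.mkQ_apply, Submodule.Quotient.mk_eq_zero]
    exact ⟨-m, by simp⟩
  have : l (jN (α m)) = α m := LinearMap.congr_fun hl _
  simp only [LinearMap.comp_apply, LinearMap.inr_apply]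
  rw [e]
  exact this

/-- Vanishing of Ext yields lifting of maps along the surjection. -/
lemma ext_lift {X N Z Y : Type} [AddCommGroup X] [Module A X] [AddCommGroup N] [Module A N]
    [AddCommGroup Z] [Module A Z] [AddCommGroup Y] [Module A Y]
    (h : Ext1Vanish A X N) (j : N →ₗ[A] Y) (g : Y →ₗ[A] Z)
    (hj : Injective j) (hg : Surjective g) (hjg : LinearMap.range j = LinearMap.ker g)
    (β : X →ₗ[A] Z) : ∃ γ : X →ₗ[A] Y, ∀ x, g (γ x) = β x := by
  let S : Submodule A (Y × X) :=
    LinearMap.ker (g ∘ₗ LinearMap.fst A Y X - β ∘ₗ LinearMap.snd A Y X)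
  have hS : ∀ z : Y × X, z ∈ S ↔ g z.1 = β z.2 := fun z => by
    simp [S, sub_eq_zero]
  have hgj : ∀ m, g (j m) = 0 := fun m => by
    have : j m ∈ LinearMap.ker g := hjg ▸ ⟨m, rfl⟩
    exact this
  let jN : N →ₗ[A] S := LinearMap.codRestrict S (LinearMap.inl A Y X ∘ₗ j) (fun n => by
    simp [hS, hgj])
  let gX : S →ₗ[A] X := LinearMap.snd A Y X ∘ₗ S.subtype
  have h1 : Injective jN := by
    intro a b hab
    apply hj
    exact congrArg (fun z : S => z.1.1) hab
  have h2 : Surjective gX := by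
    intro x
    obtain ⟨y, hy⟩ := hg (β x)
    exact ⟨⟨(y, x), (hS _).2 hy⟩, rfl⟩
  have h3 : LinearMap.range jN = LinearMap.ker gX := by
    apply le_antisymm
    · rintro _ ⟨n, rfl⟩
      rfl
    · rintro ⟨⟨y, x⟩, hz⟩ hx
      have hx : x = 0 := hx
      subst hx
      have hy : y ∈ LinearMap.range j := by
        rw [hjg]; simpa using (hS _).1 hz
      obtain ⟨n, rfl⟩ := hy
      exact ⟨n, rfl⟩
  obtain ⟨s, hs⟩ := h (ModuleCat.of A S) jN gX h1 h2 h3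
  refine ⟨LinearMap.fst A Y X ∘ₗ S.subtype ∘ₗ s, fun x => ?_⟩
  have e : (s x : S).1.2 = x := LinearMap.congr_fun hs x
  have := (hS _).1 (s x : S).2
  rw [e] at this
  exact this

lemma ext_add {T : Type} [AddCommGroup T] [Module A T] (h : Ext1Vanish A T T)
    {X N : ModuleCat.{0} A} (hX : InAdd A T X) (hN : InAdd A T N) : Ext1Vanish A X N := by
  have h1 : Ext1Vanish A T N := by
    intro Y j g hj hg hjg
    obtain ⟨n, N', ⟨e⟩⟩ := hN
    have := fun k : Fin n => ext_extend h j g hj hg hjg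
      (LinearMap.proj k ∘ₗ e.toLinearMap ∘ₗ LinearMap.inl A N N')
    choose β hβ using this
    have hex : Function.Exact j g := LinearMap.exact_iff.2 hjg.symm
    refine ((hex.split_tfae'.out 0 1 rfl rfl).2 ⟨hg,
      LinearMap.fst A N N' ∘ₗ e.symm.toLinearMap ∘ₗ LinearMap.pi β, ?_⟩).2
    ext m
    have : LinearMap.pi β (j m) = e (m, 0) := by
      ext k
      simp [hβ]
    simp [this]
  intro Y j g hj hg hjg
  obtain ⟨n, X', ⟨e⟩⟩ := hX
  have := fun k : Fin n => ext_lift h1 j g hj hg hjg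
    (LinearMap.fst A X X' ∘ₗ e.symm.toLinearMap ∘ₗ LinearMap.single A (fun _ => T) k)
  choose γ hγ using this
  have key : g ∘ₗ LinearMap.lsum A (fun _ : Fin n => T) ℕ γ =
      LinearMap.fst A X X' ∘ₗ e.symm.toLinearMap := by
    apply LinearMap.pi_ext'
    intro k
    ext t
    have : (LinearMap.lsum A (fun _ : Fin n => T) ℕ γ) (Pi.single k t) = γ k t := by
      rw [LinearMap.lsum_apply, LinearMap.sum_apply, Finset.sum_eq_single k]
      · simp
      · intro b _ hb
        simp [Pi.single_eq_of_ne hb]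
      · simp
    change g ((LinearMap.lsum A (fun _ : Fin n => T) ℕ γ) (Pi.single k t)) = _
    rw [this]
    exact hγ k t
  refine ⟨LinearMap.lsum A (fun _ : Fin n => T) ℕ γ ∘ₗ e.toLinearMap ∘ₗ LinearMap.inl A X X', ?_⟩
  ext x
  have := LinearMap.congr_fun key (e (x, 0))
  simpa using this

lemma proj_of_inj (hh : ∀ I : Ideal A, Module.Projective A ↥I) (n : ℕ) :
    ∀ (N : Type) [AddCommGroup N] [Module A N] (f : N →ₗ[A] (Fin n → A)), Injective f →
      Module.Projective A N := by
  induction n with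
  | zero =>
    intro N _ _ f hf
    have : Subsingleton N := hf.subsingleton
    infer_instance
  | succ n ih =>
    intro N _ _ f hf
    let a : N →ₗ[A] A := LinearMap.proj 0 ∘ₗ f
    have hp : Module.Projective A (LinearMap.range a) := hh _
    have hk : Module.Projective A (LinearMap.ker a) := by
      apply ih _ (LinearMap.funLeft A A Fin.succ ∘ₗ f ∘ₗ (LinearMap.ker a).subtype)
      intro x y hxy
      apply Subtype.ext
      apply hf
      ext k
      refine Fin.cases ?_ (fun k => ?_) k
      · have hx : f x.1 0 = 0 := x.2
        have hy : f y.1 0 = 0 := y.2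
        rw [hx, hy]
      · exact congrFun hxy k
    obtain ⟨s, hs⟩ := Module.projective_lifting_property a.rangeRestrict LinearMap.id
      a.surjective_rangeRestrict
    have hex : Function.Exact (LinearMap.ker a).subtype a.rangeRestrict := by
      rw [LinearMap.exact_iff]; simp
    obtain ⟨e, -⟩ := (hex.split_tfae'.out 0 2 rfl rfl).1 ⟨Subtype.val_injective, s, hs⟩
    exact Module.Projective.of_equiv' e.symm

/-- Happel and Ringel: the image of an endomorphism of a rigid module is a summand. -/
lemma happel_ringel (hh : ∀ I : Ideal A, Module.Projective A ↥I) {X : Type} [AddCommGroup X]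
    [Module A X] [Module.Finite A X] (hX : Ext1Vanish A X X) (h : X →ₗ[A] X) :
    ∃ (ρ : LinearMap.range h →ₗ[A] X) (r : X →ₗ[A] LinearMap.range h),
      ∀ x, h.rangeRestrict (ρ x) + r x.1 = x := by
  obtain ⟨n, π, hπ⟩ := Module.Finite.exists_fin' A X
  let I := LinearMap.range h
  let Ω : Submodule A (Fin n → A) := I.comap π
  have : Module.Projective A Ω := proj_of_inj hh n Ω Ω.subtype Subtype.val_injective
  let πΩ : Ω →ₗ[A] I := LinearMap.codRestrict I (π ∘ₗ Ω.subtype) (fun w => w.2)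
  obtain ⟨l, hl⟩ := Module.projective_lifting_property h.rangeRestrict πΩ
    h.surjective_rangeRestrict
  have hl' : ∀ w : Ω, h (l w) = π w.1 := fun w =>
    congrArg Subtype.val (LinearMap.congr_fun hl w)
  let S : Submodule A (X × (Fin n → A)) := LinearMap.range (l.prod (-Ω.subtype))
  let g₀ : X × (Fin n → A) →ₗ[A] X := h.coprod π
  have hS : S ≤ LinearMap.ker g₀ := by
    rintro _ ⟨w, rfl⟩
    simp [g₀, hl']
  let gY : ((X × (Fin n → A)) ⧸ S) →ₗ[A] X := S.liftQ g₀ hS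
  have gYm : ∀ z, gY (S.mkQ z) = g₀ z := fun z => by simp [gY]
  let g : (I × ((X × (Fin n → A)) ⧸ S)) →ₗ[A] X := (-I.subtype).coprod gY
  let j : X →ₗ[A] I × ((X × (Fin n → A)) ⧸ S) :=
    h.rangeRestrict.prod (S.mkQ ∘ₗ LinearMap.inl A X _)
  have h1 : Injective j := by
    rw [← LinearMap.ker_eq_bot, LinearMap.ker_eq_bot']
    intro x hx
    have hx2 : S.mkQ (x, 0) = 0 := congrArg Prod.snd hx
    rw [Submodule.mkQ_apply, Submodule.Quotient.mk_eq_zero] at hx2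
    obtain ⟨w, hw⟩ := hx2
    have hw1 : l w = x := congrArg Prod.fst hw
    have hw2 : -w.1 = 0 := congrArg Prod.snd hw
    have : w = 0 := Subtype.ext (by simpa using hw2)
    rw [← hw1, this, map_zero]
  have h2 : Surjective g := by
    intro x
    obtain ⟨p, rfl⟩ := hπ x
    refine ⟨(0, S.mkQ (0, p)), ?_⟩
    simp only [g, LinearMap.coprod_apply, gYm]
    simp [g₀]
  have h3 : LinearMap.range j = LinearMap.ker g := by
    apply le_antisymm
    · rintro _ ⟨x, rfl⟩
      simp only [LinearMap.mem_ker, g, j, LinearMap.coprod_apply, LinearMap.prod_apply,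
        Function.prod_apply, LinearMap.comp_apply, gYm]
      simp [g₀]
    · rintro ⟨x, z⟩ hz
      obtain ⟨⟨m, p⟩, rfl⟩ := S.mkQ_surjective z
      have hz' : -x.1 + (h m + π p) = 0 := by
        have : -x.1 + gY (S.mkQ (m, p)) = 0 := hz
        rw [gYm] at this
        simpa [g₀] using this
      have hx : x.1 = h m + π p := by
        rw [neg_add_eq_zero] at hz'; exact hz'
      have hp : p ∈ Ω := by
        have : π p = x.1 - h m := by rw [hx]; abel
        change π p ∈ I
        rw [this]
        exact I.sub_mem x.2 ⟨m, rfl⟩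
      refine ⟨m + l ⟨p, hp⟩, ?_⟩
      apply Prod.ext
      · apply Subtype.ext
        change h (m + l ⟨p, hp⟩) = x.1
        rw [map_add, hl', hx]
      · change S.mkQ (m + l ⟨p, hp⟩, 0) = S.mkQ (m, p)
        rw [← sub_eq_zero, ← map_sub, Submodule.mkQ_apply, Submodule.Quotient.mk_eq_zero]
        exact ⟨⟨p, hp⟩, by simp⟩
  obtain ⟨s, hs⟩ := hX (ModuleCat.of A (I × ((X × (Fin n → A)) ⧸ S))) j g h1 h2 h3
  have hs' : ∀ x, g (s x) = x := fun x => LinearMap.congr_fun hs x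
  -- the projection onto the kernel part
  have hker : ∀ w, w - s (g w) ∈ LinearMap.range j := fun w => by
    rw [h3, LinearMap.mem_ker, map_sub, hs', sub_self]
  let ej := LinearEquiv.ofInjective j h1
  let d : (I × ((X × (Fin n → A)) ⧸ S)) →ₗ[A] LinearMap.range j :=
    LinearMap.codRestrict _ (LinearMap.id - s ∘ₗ g) hker
  let ρ := ej.symm.toLinearMap ∘ₗ d
  have hρ : ∀ w, j (ρ w) + s (g w) = w := fun w => by
    have : j (ρ w) = w - s (g w) := by
      have := congrArg Subtype.val (ej.apply_symm_apply (d w))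
      exact this
    rw [this, sub_add_cancel]
  refine ⟨ρ ∘ₗ LinearMap.inl A I _, -(LinearMap.fst A I _ ∘ₗ s), fun x => ?_⟩
  have := congrArg Prod.fst (hρ (x, 0))
  have hg : g (x, 0) = -x.1 := by simp [g]
  rw [hg, map_neg] at this
  exact this

lemma inAdd_of_isCompl {T : Type} [AddCommGroup T] [Module A T] {X : ModuleCat.{0} A}
    (hX : InAdd A T X) (p q : Submodule A X) (h : IsCompl p q) :
    InAdd A T (ModuleCat.of A p) := by
  obtain ⟨n, Y, ⟨e⟩⟩ := hX
  exact ⟨n, ModuleCat.of A (q × Y),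
    ⟨(LinearEquiv.prodAssoc A p q Y).symm ≪≫ₗ
      (LinearEquiv.prodCongr (Submodule.prodEquivOfIsCompl p q h) (LinearEquiv.refl A Y)) ≪≫ₗ e⟩⟩

lemma finite_of_inAdd {T : Type} [AddCommGroup T] [Module A T] [Module.Finite A T]
    {X : ModuleCat.{0} A} (hX : InAdd A T X) : Module.Finite A X := by
  obtain ⟨n, Y, ⟨e⟩⟩ := hX
  refine Module.Finite.of_surjective (LinearMap.fst A X Y ∘ₗ e.symm.toLinearMap) ?_
  exact (LinearMap.fst_surjective (R := A) (M := X) (M₂ := Y)).comp e.symm.surjective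

/-- The coresolutions. -/
def IsCores (A : Type) [Ring A] (T : Type) [AddCommGroup T] [Module A T]
    (T₁ T₂ : ModuleCat.{0} A) (i : A →ₗ[A] ↑T₁) (q : ↑T₁ →ₗ[A] ↑T₂) : Prop :=
  InAdd A T T₁ ∧ InAdd A T T₂ ∧ Injective i ∧ Surjective q ∧
        LinearMap.range i = LinearMap.ker q

lemma cores_shrink {T : Type} [AddCommGroup T] [Module A T]
    {T₁ T₂ : ModuleCat.{0} A} {i : A →ₗ[A] ↑T₁} {q : ↑T₁ →ₗ[A] ↑T₂}
    (H : IsCores A T T₁ T₂ i q) (p r : Submodule A T₁) (hpr : IsCompl p r)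
    (hi : LinearMap.range i ≤ p) :
    ∃ (T₂' : ModuleCat.{0} A) (i' : A →ₗ[A] ↑(ModuleCat.of A p))
      (q' : ↑(ModuleCat.of A p) →ₗ[A] ↑T₂'),
      IsCores A T (ModuleCat.of A p) T₂' i' q' := by
  obtain ⟨H1, H2, H3, H4, H5⟩ := H
  have hc : IsCompl (p.map q) (r.map q) := by
    constructor
    · rw [Submodule.disjoint_def]
      rintro _ ⟨a, ha, rfl⟩ ⟨b, hb, hab⟩
      have h0 : b - a ∈ LinearMap.ker q := by simp [hab]
      rw [← H5] at h0
      have hbp : b ∈ p := by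
        have := p.add_mem (hi h0) ha
        simpa using this
      have : b = 0 := Submodule.disjoint_def.1 hpr.disjoint b hbp hb
      rw [← hab, this, map_zero]
    · rw [codisjoint_iff, ← Submodule.map_sup, hpr.sup_eq_top, Submodule.map_top,
        LinearMap.range_eq_top.2 H4]
  refine ⟨ModuleCat.of A (p.map q), LinearMap.codRestrict p i (fun a => hi ⟨a, rfl⟩),
    LinearMap.codRestrict (p.map q) (q ∘ₗ p.subtype) (fun x => ⟨x.1, x.2, rfl⟩),
    inAdd_of_isCompl H1 p r hpr, inAdd_of_isCompl H2 _ _ hc, ?_, ?_, ?_⟩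
  · intro a b hab
    exact H3 (congrArg Subtype.val hab)
  · rintro ⟨_, a, ha, rfl⟩
    exact ⟨⟨a, ha⟩, rfl⟩
  · ext ⟨x, hx⟩
    have : x ∈ LinearMap.range i ↔ x ∈ LinearMap.ker q := by rw [H5]
    simp only [LinearMap.mem_range, LinearMap.mem_ker] at this ⊢
    constructor
    · rintro ⟨a, ha⟩
      exact Subtype.ext (this.1 ⟨a, congrArg Subtype.val ha⟩)
    · intro hq
      obtain ⟨a, ha⟩ := this.2 (congrArg Subtype.val hq)
      exact ⟨a, Subtype.ext ha⟩

end helpers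

/-- Let `A` be a finite dimensional hereditary `K`-algebra and `T` a
finitely generated tilting `A`-module.  Then there is a short exact sequence
`0 → A → T₁ → T₂ → 0` with `T₁, T₂ ∈ add T` and `Hom_A(T₂, T₁) = 0`. -/
theorem tilting_coresolution_with_vanishing_hom
    (K A : Type) [Field K] [IsAlgClosed K] [Ring A] [Algebra K A] [FiniteDimensional K A]
    (hhered : ∀ I : Ideal A, Module.Projective A ↥I)
    (T : Type) [AddCommGroup T] [Module A T] [Module.Finite A T]
    (hpd : ProjDimLEOne A T) (hext : Ext1Vanish A T T)
    (hT3 : ∃ (T₁ T₂ : ModuleCat.{0} A) (i : A →ₗ[A] ↑T₁) (q : ↑T₁ →ₗ[A] ↑T₂),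
      InAdd A T T₁ ∧ InAdd A T T₂ ∧ Injective i ∧ Surjective q ∧
        LinearMap.range i = LinearMap.ker q) :
    ∃ (T₁ T₂ : ModuleCat.{0} A) (i : A →ₗ[A] ↑T₁) (q : ↑T₁ →ₗ[A] ↑T₂),
      InAdd A T T₁ ∧ InAdd A T T₂ ∧ Injective i ∧ Surjective q ∧
        LinearMap.range i = LinearMap.ker q ∧
        ∀ g : ↑T₂ →ₗ[A] ↑T₁, g = 0 := by
  have hAart : IsArtinianRing A := IsArtinianRing.of_finite K A
  -- choose a coresolution of minimal length
  let L : Set ℕ∞ := {c | ∃ (T₁ T₂ : ModuleCat.{0} A) (i : A →ₗ[A] ↑T₁) (q : ↑T₁ →ₗ[A] ↑T₂),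
    IsCores A T T₁ T₂ i q ∧ Module.length A T₁ = c}
  have hL : L.Nonempty := by
    obtain ⟨T₁, T₂, i, q, H⟩ := hT3
    exact ⟨_, T₁, T₂, i, q, H, rfl⟩
  obtain ⟨c, ⟨T₁, T₂, i, q, H, hc⟩, hmin⟩ := wellFounded_lt.has_min L hL
  have hfin : Module.Finite A T₁ := finite_of_inAdd H.1
  have hnil : ∀ h : T₁ →ₗ[A] T₁, (∀ a, h (i a) = 0) →
      IsNilpotent (h : Module.End A T₁) := by
    intro h hh
    obtain ⟨N, hN⟩ := Filter.eventually_atTop.1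
      (LinearMap.eventually_isCompl_ker_pow_range_pow (R := A) (M := T₁) h)
    have hcm := hN (N + 1) (by omega)
    have hle : LinearMap.range i ≤ LinearMap.ker ((h : Module.End A T₁) ^ (N + 1)) := by
      rintro _ ⟨a, rfl⟩
      rw [LinearMap.mem_ker, pow_succ, Module.End.mul_apply, hh, map_zero]
    obtain ⟨T₂', i', q', H'⟩ := cores_shrink H _ _ hcm hle
    have htop : LinearMap.ker ((h : Module.End A T₁) ^ (N + 1)) = ⊤ := by
      by_contra hne
      exact hmin _ ⟨_, T₂', i', q', H', rfl⟩ (hc ▸ Submodule.length_lt hne)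
    exact ⟨N + 1, LinearMap.ker_eq_top.1 htop⟩
  obtain ⟨H1, H2, H3, H4, H5⟩ := H
  refine ⟨T₁, T₂, i, q, H1, H2, H3, H4, H5, fun f => ?_⟩
  have hqi : ∀ a, q (i a) = 0 := fun a => by
    have : i a ∈ LinearMap.ker q := H5 ▸ ⟨a, rfl⟩
    exact this
  let h : T₁ →ₗ[A] T₁ := f ∘ₗ q
  let p := h.rangeRestrict
  have hpi : ∀ a, p (i a) = 0 := fun a => Subtype.ext (by
    change f (q (i a)) = 0
    rw [hqi, map_zero])
  obtain ⟨ρ, r, hρr⟩ := happel_ringel hhered (ext_add hext H1 H1) h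
  -- modify r by something factoring through p so that it kills A
  obtain ⟨u, hu⟩ := Module.projective_lifting_property p (r ∘ₗ i) h.surjective_rangeRestrict
  obtain ⟨φ, hφ⟩ := ext_extend (ext_add hext H2 H1) i q H3 H4 H5 u
  let k : T₁ →ₗ[A] LinearMap.range h := r - p ∘ₗ φ
  have hki : ∀ a, k (i a) = 0 := fun a => by
    have : p (u a) = r (i a) := LinearMap.congr_fun hu a
    simp [k, hφ, this]
  let ι := (LinearMap.range h).subtype
  let x : Module.End A (LinearMap.range h) := k ∘ₗ ι
  have hxnil : IsNilpotent x := by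
    obtain ⟨n, hn⟩ := hnil (ι ∘ₗ k) (fun a => by simp [hki])
    have hpow : ∀ m (z : LinearMap.range h),
        ι ((x ^ m) z) = (((ι ∘ₗ k : T₁ →ₗ[A] T₁) : Module.End A T₁) ^ m) (ι z) := by
      intro m
      induction m with
      | zero => intro z; rfl
      | succ m ih =>
        intro z
        rw [pow_succ, pow_succ, Module.End.mul_apply, Module.End.mul_apply, ih]
        rfl
    refine ⟨n, LinearMap.ext fun z => Subtype.ext ?_⟩
    have := hpow n z
    rw [hn] at this
    exact this
  obtain ⟨v, hv⟩ := hxnil.isUnit_one_sub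
  let ψ₀ : LinearMap.range h →ₗ[A] T₁ := ρ + φ ∘ₗ ι
  have hψ₀ : ∀ z, p (ψ₀ z) = (v : Module.End A (LinearMap.range h)) z := by
    intro z
    rw [hv]
    have h1 := hρr z
    change p (ρ z + φ z.1) = z - (r z.1 - p (φ z.1))
    rw [map_add]
    have h2 : p (ρ z) = z - r z.1 := eq_sub_of_add_eq h1
    rw [h2]; abel
  let ψ : LinearMap.range h →ₗ[A] T₁ :=
    ψ₀ ∘ₗ ((v⁻¹ : (Module.End A (LinearMap.range h))ˣ) : Module.End A (LinearMap.range h))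
  have hψ : ∀ z, p (ψ z) = z := by
    intro z
    change p (ψ₀ _) = z
    rw [hψ₀, ← Module.End.mul_apply, Units.mul_inv, Module.End.one_apply]
  obtain ⟨n, hn⟩ := hnil (ψ ∘ₗ p) (fun a => by simp [hpi])
  have hfix : ∀ m (z : LinearMap.range h),
      (((ψ ∘ₗ p : T₁ →ₗ[A] T₁) : Module.End A T₁) ^ m) (ψ z) = ψ z := by
    intro m
    induction m with
    | zero => intro z; rfl
    | succ m ih =>
      intro z
      rw [pow_succ, Module.End.mul_apply]
      change (((ψ ∘ₗ p : T₁ →ₗ[A] T₁) : Module.End A T₁) ^ m) (ψ (p (ψ z))) = ψ z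
      rw [hψ, ih]
  have hz : ∀ z : LinearMap.range h, z = 0 := fun z => by
    have h1 := hfix n z
    rw [hn, LinearMap.zero_apply] at h1
    rw [← hψ z, ← h1, map_zero]
  ext t
  obtain ⟨y, rfl⟩ := H4 t
  exact congrArg Subtype.val (hz (p y))

end
end

section
/- Let A be a finite dimensional algebra, T a finitely generated A-module with Gen T a torsion class, and suppose T is Ext-projective in Gen T (i.e. Ext_A^1(T, X) = 0 for all X ∈ Gen T). If T is a faithful τ-tilting module, then T is a tilting module. -/
noncomputable section
open Function

/-- A module is uniserial if its submodules are totally ordered by inclusion. -/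
def IsUniserial (A : Type) [Ring A] (M : Type) [AddCommGroup M] [Module A M] : Prop :=
  ∀ U V : Submodule A M, U ≤ V ∨ V ≤ U

/-- An indecomposable module: nonzero, and every direct sum decomposition is trivial. -/
def Indec (A : Type) [Ring A] (M : Type) [AddCommGroup M] [Module A M] : Prop :=
  Nontrivial M ∧ ∀ X Y : ModuleCat.{0} A, Nonempty (M ≃ₗ[A] (↑X × ↑Y)) →
    Subsingleton X ∨ Subsingleton Y

/-- A ring is a Nakayama algebra if every finitely generated indecomposable projective
module and every finitely generated indecomposable injective module is uniserial. -/
def IsNakayamaAlgebra (A : Type) [Ring A] : Prop :=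
  (∀ P : ModuleCat.{0} A, Module.Finite A P → Module.Projective A P → Indec A P →
    IsUniserial A P) ∧
  (∀ Q : ModuleCat.{0} A, Module.Finite A Q → Module.Injective A Q → Indec A Q →
    IsUniserial A Q)

/-- `X ∈ Gen T`: `X` is a quotient of a finite direct sum of copies of `T`. -/
def InGenT (A : Type) [Ring A] (T : Type) [AddCommGroup T] [Module A T]
    (X : ModuleCat.{0} A) : Prop :=
  ∃ (n : ℕ) (p : (Fin n → T) →ₗ[A] ↑X), Surjective p

/-- `T` has exactly `k` pairwise non-isomorphic indecomposable direct summands. -/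
def HasIndecCount (A : Type) [Ring A] (T : Type) [AddCommGroup T] [Module A T]
    (k : ℕ) : Prop :=
  ∃ (M : Fin k → ModuleCat.{0} A) (m : Fin k → ℕ),
    (∀ i, Indec A (M i)) ∧ (∀ i, 0 < m i) ∧
    (∀ i j, i ≠ j → IsEmpty (↑(M i) ≃ₗ[A] ↑(M j))) ∧
    Nonempty (T ≃ₗ[A] ((i : Fin k) → Fin (m i) → ↑(M i)))

/-- Unbundled version of `InGenT`. -/
def Gen (A T X : Type) [Ring A] [AddCommGroup T] [Module A T] [AddCommGroup X] [Module A X] :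
    Prop := ∃ (n : ℕ) (p : (Fin n → T) →ₗ[A] X), Surjective p

/-- `X` is projective relative to surjections with kernel in `Gen T`. -/
def ExtP (A T X : Type) [Ring A] [AddCommGroup T] [Module A T] [AddCommGroup X] [Module A X] :
    Prop := ∀ (E C : Type) [AddCommGroup E] [Module A E] [AddCommGroup C] [Module A C]
      (g : E →ₗ[A] C), Surjective g → Gen A T (LinearMap.ker g) →
      ∀ q : X →ₗ[A] C, ∃ l : X →ₗ[A] E, g ∘ₗ l = q

section basics
variable {A T : Type} [Ring A] [AddCommGroup T] [Module A T]
variable {X Y Z : Type} [AddCommGroup X] [Module A X] [AddCommGroup Y] [Module A Y]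
  [AddCommGroup Z] [Module A Z]

theorem Gen.quot (h : Gen A T X) (f : X →ₗ[A] Y) (hf : Surjective f) : Gen A T Y := by
  obtain ⟨n, p, hp⟩ := h
  exact ⟨n, f ∘ₗ p, hf.comp hp⟩

theorem Gen.ofFintype {ι : Type} [Fintype ι] (p : (ι → T) →ₗ[A] X) (hp : Surjective p) :
    Gen A T X := by
  let e := LinearEquiv.funCongrLeft A T (Fintype.equivFin ι)
  exact ⟨Fintype.card ι, p ∘ₗ e.toLinearMap, hp.comp e.surjective⟩

theorem Gen.self : Gen A T T :=
  ⟨1, LinearMap.proj 0, fun x => ⟨fun _ => x, rfl⟩⟩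

theorem Gen.pow (n : ℕ) : Gen A T (Fin n → T) :=
  ⟨n, LinearMap.id, fun x => ⟨x, rfl⟩⟩

theorem Gen.prod (hX : Gen A T X) (hY : Gen A T Y) : Gen A T (X × Y) := by
  obtain ⟨n, p, hp⟩ := hX
  obtain ⟨m, q, hq⟩ := hY
  let e := LinearEquiv.sumArrowLequivProdArrow (Fin n) (Fin m) A T
  exact Gen.ofFintype (p.prodMap q ∘ₗ e.toLinearMap) ((hp.prodMap hq).comp e.surjective)

theorem Gen.finite [Module.Finite A T] (hX : Gen A T X) : Module.Finite A X := by
  obtain ⟨n, p, hp⟩ := hX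
  exact Module.Finite.of_surjective p hp

theorem ExtP.of_retract (hX : ExtP A T X) (s : Y →ₗ[A] X) (r : X →ₗ[A] Y)
    (h : r ∘ₗ s = LinearMap.id) : ExtP A T Y := by
  intro E C _ _ _ _ g hg hk q
  obtain ⟨l, hl⟩ := hX E C g hg hk (q ∘ₗ r)
  refine ⟨l ∘ₗ s, ?_⟩
  rw [← LinearMap.comp_assoc, hl, LinearMap.comp_assoc, h, LinearMap.comp_id]

theorem ExtP.prod (hX : ExtP A T X) (hY : ExtP A T Y) : ExtP A T (X × Y) := by
  intro E C _ _ _ _ g hg hk q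
  obtain ⟨l, hl⟩ := hX E C g hg hk (q ∘ₗ LinearMap.inl A X Y)
  obtain ⟨m, hm⟩ := hY E C g hg hk (q ∘ₗ LinearMap.inr A X Y)
  refine ⟨l.coprod m, ?_⟩
  apply LinearMap.prod_ext
  · rw [LinearMap.comp_assoc, LinearMap.coprod_inl, hl]
  · rw [LinearMap.comp_assoc, LinearMap.coprod_inr, hm]

theorem ExtP.pow (hX : ExtP A T X) (n : ℕ) : ExtP A T (Fin n → X) := by
  intro E C _ _ _ _ g hg hk q
  choose l hl using fun i => hX E C g hg hk (q ∘ₗ LinearMap.single A (fun _ : Fin n => X) i)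
  refine ⟨∑ i, l i ∘ₗ LinearMap.proj i, ?_⟩
  apply LinearMap.pi_ext
  intro i x
  have := LinearMap.congr_fun (hl i) x
  simp only [LinearMap.comp_apply, LinearMap.single_apply] at this
  rw [← this, LinearMap.comp_apply, LinearMap.sum_apply]
  congr 1
  rw [Finset.sum_eq_single i]
  · simp
  · intro j _ hj
    simp [Pi.single_eq_of_ne hj]
  · simp

theorem extP_of_ext1Vanish (h : ∀ X : ModuleCat.{0} A, InGenT A T X → Ext1Vanish A T ↑X) :
    ExtP A T T := by
  intro E C _ _ _ _ g hg hk q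
  let W : Submodule A (E × T) :=
    LinearMap.ker (g ∘ₗ LinearMap.fst A E T - q ∘ₗ LinearMap.snd A E T)
  have hW : ∀ w : E × T, w ∈ W ↔ g w.1 = q w.2 := by
    intro w
    simp [W, sub_eq_zero]
  let j : LinearMap.ker g →ₗ[A] W :=
    (LinearMap.inl A E T ∘ₗ (LinearMap.ker g).subtype).codRestrict W (by
      intro x; rw [hW]; simp)
  let p : W →ₗ[A] T := LinearMap.snd A E T ∘ₗ W.subtype
  obtain ⟨s, hs⟩ := h (ModuleCat.of A (LinearMap.ker g)) hk (ModuleCat.of A W) j p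
    (by
      intro x y hxy
      have := congrArg (fun w : W => w.1.1) hxy
      exact Subtype.ext this)
    (by
      intro t
      obtain ⟨e, he⟩ := hg (q t)
      exact ⟨⟨(e, t), (hW _).2 he⟩, rfl⟩)
    (by
      ext w
      constructor
      · rintro ⟨x, rfl⟩
        rfl
      · intro hw
        have h2 : w.1.2 = 0 := hw
        have h1 := (hW w.1).1 w.2
        rw [h2, map_zero] at h1
        refine ⟨⟨w.1.1, h1⟩, ?_⟩
        apply Subtype.ext
        exact Prod.ext rfl h2.symm)
  refine ⟨LinearMap.fst A E T ∘ₗ W.subtype ∘ₗ s, ?_⟩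
  ext t
  have h1 := (hW (s t).1).1 (s t).2
  have h2 : (s t).1.2 = t := LinearMap.congr_fun hs t
  rw [h2] at h1
  exact h1

/-- Extension of maps along an injection with `Ext`-projective cokernel. -/
theorem ExtP.extend {P : Type} [AddCommGroup P] [Module A P] (hX : ExtP A T X)
    (hY : Gen A T Y) (i : P →ₗ[A] Z) (q : Z →ₗ[A] X) (hi : Injective i) (hq : Surjective q)
    (hiq : LinearMap.range i = LinearMap.ker q) (f : P →ₗ[A] Y) :
    ∃ h : Z →ₗ[A] Y, h ∘ₗ i = f := by
  let R : Submodule A (Z × Y) := LinearMap.range (i.prod (-f))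
  have hqi : ∀ x, q (i x) = 0 := fun x => by
    have : i x ∈ LinearMap.ker q := hiq ▸ ⟨x, rfl⟩
    exact this
  let g : ((Z × Y) ⧸ R) →ₗ[A] X := R.liftQ (q ∘ₗ LinearMap.fst A Z Y) (by
    rintro _ ⟨x, rfl⟩
    simp [hqi])
  have hg : Surjective g := by
    intro x
    obtain ⟨z, rfl⟩ := hq x
    exact ⟨R.mkQ (z, 0), rfl⟩
  let j0 : Y →ₗ[A] ((Z × Y) ⧸ R) := R.mkQ ∘ₗ LinearMap.inr A Z Y
  have hj0 : Injective j0 := by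
    rw [← LinearMap.ker_eq_bot, LinearMap.ker_eq_bot']
    intro y hy
    have : ((0 : Z), y) ∈ R := (Submodule.Quotient.mk_eq_zero R).1 hy
    obtain ⟨x, hx⟩ := this
    have h1 : i x = 0 := congrArg Prod.fst hx
    have h2 : -f x = y := congrArg Prod.snd hx
    have : x = 0 := hi (by rw [h1, map_zero])
    rw [← h2, this]; simp
  have hker : ∀ e, g e = 0 → ∃ y, j0 y = e := by
    intro e he
    obtain ⟨⟨z, y⟩, rfl⟩ := R.mkQ_surjective e
    have hz : z ∈ LinearMap.ker q := he
    rw [← hiq] at hz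
    obtain ⟨x, rfl⟩ := hz
    refine ⟨y + f x, ?_⟩
    apply (Submodule.Quotient.eq R).2
    exact ⟨-x, by simp⟩
  have hgj : ∀ y, g (j0 y) = 0 := fun y => by
    change q 0 = 0
    simp
  let j : Y →ₗ[A] LinearMap.ker g := j0.codRestrict _ hgj
  have hj : Surjective j := by
    rintro ⟨e, he⟩
    obtain ⟨y, hy⟩ := hker e he
    exact ⟨y, Subtype.ext hy⟩
  have hjinj : Injective j := fun a b hab => hj0 (congrArg Subtype.val hab)
  obtain ⟨s, hs⟩ := hX _ _ g hg (hY.quot j hj) LinearMap.id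
  let e := LinearEquiv.ofBijective j ⟨hjinj, hj⟩
  let r : ((Z × Y) ⧸ R) →ₗ[A] LinearMap.ker g :=
    (LinearMap.id - s ∘ₗ g).codRestrict _ (by
      intro c
      have := LinearMap.congr_fun hs (g c)
      simp only [LinearMap.comp_apply, LinearMap.id_apply] at this
      simp [this])
  refine ⟨e.symm.toLinearMap ∘ₗ r ∘ₗ R.mkQ ∘ₗ LinearMap.inl A Z Y, ?_⟩
  ext x
  change e.symm (r (R.mkQ (i x, 0))) = f x
  rw [LinearEquiv.symm_apply_eq]
  apply Subtype.ext
  change R.mkQ (i x, 0) - s (q (i x)) = R.mkQ (0, f x)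
  rw [hqi, map_zero, sub_zero]
  apply (Submodule.Quotient.eq R).2
  exact ⟨x, by simp⟩

/-- Dual Schanuel lemma. -/
theorem schanuel {P U V C D : Type} [AddCommGroup P] [Module A P] [AddCommGroup U] [Module A U]
    [AddCommGroup V] [Module A V] [AddCommGroup C] [Module A C] [AddCommGroup D] [Module A D]
    (hU : Gen A T U) (hV : Gen A T V) (hC : ExtP A T C) (hD : ExtP A T D)
    (i : P →ₗ[A] U) (q : U →ₗ[A] C) (hi : Injective i) (hq : Surjective q)
    (hiq : LinearMap.range i = LinearMap.ker q)
    (j : P →ₗ[A] V) (r : V →ₗ[A] D) (hj : Injective j) (hr : Surjective r)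
    (hjr : LinearMap.range j = LinearMap.ker r) : Nonempty ((U × D) ≃ₗ[A] (V × C)) := by
  obtain ⟨a, ha⟩ := hD.extend hU j r hj hr hjr i
  obtain ⟨b, hb⟩ := hC.extend hV i q hi hq hiq j
  have ha' : ∀ x, a (j x) = i x := LinearMap.congr_fun ha
  have hb' : ∀ x, b (i x) = j x := LinearMap.congr_fun hb
  have hqi : ∀ x, q (i x) = 0 := fun x => by
    have : i x ∈ LinearMap.ker q := hiq ▸ ⟨x, rfl⟩
    exact this
  have hrj : ∀ x, r (j x) = 0 := fun x => by
    have : j x ∈ LinearMap.ker r := hjr ▸ ⟨x, rfl⟩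
    exact this
  let φ : (U × V) →ₗ[A] (U × D) :=
    (LinearMap.fst A U V - a ∘ₗ LinearMap.snd A U V).prod (r ∘ₗ LinearMap.snd A U V)
  let ψ : (U × V) →ₗ[A] (V × C) :=
    (LinearMap.snd A U V - b ∘ₗ LinearMap.fst A U V).prod (q ∘ₗ LinearMap.fst A U V)
  have hφ : Surjective φ := by
    rintro ⟨u, d⟩
    obtain ⟨v, rfl⟩ := hr d
    exact ⟨(u + a v, v), by simp [φ]⟩
  have hψ : Surjective ψ := by
    rintro ⟨v, c⟩
    obtain ⟨u, rfl⟩ := hq c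
    exact ⟨(u, v + b u), by simp [ψ]⟩
  have hk : LinearMap.ker φ = LinearMap.ker ψ := by
    ext ⟨u, v⟩
    have h1 : (u, v) ∈ LinearMap.ker φ ↔ u = a v ∧ r v = 0 := by
      simp [φ, sub_eq_zero]
    have h2 : (u, v) ∈ LinearMap.ker ψ ↔ v = b u ∧ q u = 0 := by
      simp [ψ, sub_eq_zero]
    rw [h1, h2]
    constructor
    · rintro ⟨h, hv⟩
      have : v ∈ LinearMap.range j := hjr ▸ hv
      obtain ⟨x, rfl⟩ := this
      rw [h, ha', hb', hqi]; exact ⟨rfl, rfl⟩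
    · rintro ⟨h, hv⟩
      have : u ∈ LinearMap.range i := hiq ▸ hv
      obtain ⟨x, rfl⟩ := this
      rw [h, hb', ha', hrj]; exact ⟨rfl, rfl⟩
  exact ⟨(φ.quotKerEquivOfSurjective hφ).symm.trans
    ((Submodule.quotEquivOfEq _ _ hk).trans (ψ.quotKerEquivOfSurjective hψ))⟩

/-- The relation in the Grothendieck group coming from a projective resolution. -/
theorem key_iso {P U0 U1 V0 V1 : Type} [AddCommGroup P] [Module A P]
    [AddCommGroup U0] [Module A U0] [AddCommGroup U1] [Module A U1]
    [AddCommGroup V0] [Module A V0] [AddCommGroup V1] [Module A V1]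
    (hX : Gen A T X) (hX' : ExtP A T X) (hU0 : Gen A T U0) (hV0 : Gen A T V0)
    (hU1 : ExtP A T U1) (hV1 : ExtP A T V1)
    (p : P →ₗ[A] X) (hp : Surjective p)
    (i : P →ₗ[A] U0) (q : U0 →ₗ[A] U1) (hi : Injective i) (hq : Surjective q)
    (hiq : LinearMap.range i = LinearMap.ker q)
    (j : LinearMap.ker p →ₗ[A] V0) (r : V0 →ₗ[A] V1) (hj : Injective j) (hr : Surjective r)
    (hjr : LinearMap.range j = LinearMap.ker r) :
    Nonempty ((U0 × V1) ≃ₗ[A] (V0 × (X × U1))) := by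
  obtain ⟨h, hh⟩ := hU1.extend hX i q hi hq hiq p
  have hh' : ∀ x, h (i x) = p x := LinearMap.congr_fun hh
  have hqi : ∀ x, q (i x) = 0 := fun x => by
    have : i x ∈ LinearMap.ker q := hiq ▸ ⟨x, rfl⟩
    exact this
  refine schanuel hU0 hV0 (hX'.prod hU1) hV1 (i ∘ₗ (LinearMap.ker p).subtype) (h.prod q)
    (hi.comp Subtype.val_injective) ?_ ?_ j r hj hr hjr
  · rintro ⟨x, u⟩
    obtain ⟨z, rfl⟩ := hq u
    obtain ⟨y, hy⟩ := hp (x - h z)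
    exact ⟨z + i y, by simp [hh', hy, hqi]⟩
  · ext u
    constructor
    · rintro ⟨x, rfl⟩
      have := x.2
      rw [LinearMap.mem_ker] at this
      simp [hh', hqi, this]
    · intro hu
      rw [LinearMap.mem_ker] at hu
      have h1 : h u = 0 := congrArg Prod.fst hu
      have h2 : u ∈ LinearMap.ker q := congrArg Prod.snd hu
      rw [← hiq] at h2
      obtain ⟨x, rfl⟩ := h2
      exact ⟨⟨x, by rw [LinearMap.mem_ker, ← hh', h1]⟩, rfl⟩

end basics

section krullSchmidt
variable {A : Type} [Ring A]

/-- A retract is a direct factor. -/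
def splitEquiv {M N : Type} [AddCommGroup M] [Module A M] [AddCommGroup N] [Module A N]
    (f : M →ₗ[A] N) (h : N →ₗ[A] M) (hf : h ∘ₗ f = LinearMap.id) :
    N ≃ₗ[A] (M × LinearMap.ker h) :=
  have hf' : ∀ x, h (f x) = x := LinearMap.congr_fun hf
  LinearEquiv.ofLinear
    (h.prod ((LinearMap.id - f ∘ₗ h).codRestrict _ (fun x => by simp [hf'])))
    (f.coprod (LinearMap.ker h).subtype)
    (by
      ext x
      · simp [hf']
      · simp [hf']
      · simp
      · simp)
    (by ext x; simp)

variable [IsArtinianRing A] [IsNoetherianRing A]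

theorem fitting {M : Type} [AddCommGroup M] [Module A M] [Module.Finite A M] (hM : Indec A M)
    (f : Module.End A M) : IsUnit f ∨ IsNilpotent f := by
  obtain ⟨n, hn, hn1⟩ := (f.eventually_isCompl_ker_pow_range_pow.and
    (Filter.eventually_ge_atTop 1)).exists
  have e := (Submodule.prodEquivOfIsCompl _ _ hn).symm
  rcases hM.2 (ModuleCat.of A (LinearMap.ker (f ^ n))) (ModuleCat.of A (LinearMap.range (f ^ n)))
    ⟨e⟩ with h | h
  · left
    have hk : LinearMap.ker (f ^ n) = ⊥ := (Submodule.subsingleton_iff_eq_bot).1 h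
    rw [hk] at hn
    have hr : LinearMap.range (f ^ n) = ⊤ := by simpa using hn.sup_eq_top
    have : IsUnit (f ^ n) := (Module.End.isUnit_iff _).2
      ⟨LinearMap.ker_eq_bot.1 hk, LinearMap.range_eq_top.1 hr⟩
    exact (isUnit_pow_iff (by omega)).1 this
  · right
    have hk : LinearMap.range (f ^ n) = ⊥ := (Submodule.subsingleton_iff_eq_bot).1 h
    exact ⟨n, LinearMap.range_eq_bot.1 hk⟩

theorem local_add {M : Type} [AddCommGroup M] [Module A M] [Module.Finite A M] (hM : Indec A M)
    (f g : Module.End A M) (h : IsUnit (f + g)) : IsUnit f ∨ IsUnit g := by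
  obtain ⟨u, hu⟩ := h
  have h1 : (↑u⁻¹ : Module.End A M) * f + ↑u⁻¹ * g = 1 := by
    rw [← mul_add, ← hu, Units.inv_mul]
  rcases fitting hM ((↑u⁻¹ : Module.End A M) * f) with h | h
  · left
    exact (Units.isUnit_units_mul _ _).1 h
  · right
    have h2 := h.isUnit_one_sub
    rw [← h1, add_sub_cancel_left] at h2
    exact (Units.isUnit_units_mul _ _).1 h2

theorem local_sum {M : Type} [AddCommGroup M] [Module A M] [Module.Finite A M] (hM : Indec A M)
    {ι : Type} (s : Finset ι) (f : ι → Module.End A M) (h : IsUnit (∑ i ∈ s, f i)) :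
    ∃ i, IsUnit (f i) := by
  classical
  haveI := hM.1
  induction s using Finset.induction_on with
  | empty => simp at h
  | insert a s ha ih =>
    rw [Finset.sum_insert ha] at h
    rcases local_add hM _ _ h with h | h
    · exact ⟨a, h⟩
    · exact ih h

theorem iso_of_isUnit {M N : Type} [AddCommGroup M] [Module A M] [AddCommGroup N] [Module A N]
    (hM : Nontrivial M) (hN : Indec A N) (f : M →ₗ[A] N) (g : N →ₗ[A] M)
    (h : IsUnit (g ∘ₗ f : Module.End A M)) : Nonempty (M ≃ₗ[A] N) := by
  obtain ⟨u, hu⟩ := h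
  let r : N →ₗ[A] M := (↑u⁻¹ : Module.End A M) ∘ₗ g
  have hr : r ∘ₗ f = LinearMap.id := by
    have : (↑u⁻¹ : Module.End A M) * (g ∘ₗ f) = 1 := by rw [← hu, Units.inv_mul]
    exact this
  rcases hN.2 (ModuleCat.of A M) (ModuleCat.of A (LinearMap.ker r)) ⟨splitEquiv f r hr⟩ with h | h
  · exact absurd h (not_subsingleton_iff_nontrivial.2 hM)
  · have hk : LinearMap.ker r = ⊥ := (Submodule.subsingleton_iff_eq_bot).1 h
    exact ⟨(LinearEquiv.ofBijective r ⟨LinearMap.ker_eq_bot.1 hk,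
      fun x => ⟨f x, LinearMap.congr_fun hr x⟩⟩).symm⟩

/-- An indecomposable retract of a finite product of indecomposables is one of them. -/
theorem iso_of_retract_pi {M : Type} [AddCommGroup M] [Module A M] [Module.Finite A M]
    (hM : Indec A M) {ι : Type} [Fintype ι] (N : ι → Type) [∀ i, AddCommGroup (N i)]
    [∀ i, Module A (N i)] (hN : ∀ i, Indec A (N i)) (s : M →ₗ[A] (∀ i, N i))
    (r : (∀ i, N i) →ₗ[A] M) (h : r ∘ₗ s = LinearMap.id) : ∃ i, Nonempty (M ≃ₗ[A] N i) := by
  classical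
  have h1 : ∑ i, ((r ∘ₗ LinearMap.single A N i) ∘ₗ (LinearMap.proj i ∘ₗ s) : Module.End A M)
      = 1 := by
    ext x
    rw [LinearMap.sum_apply]
    simp only [LinearMap.comp_apply, LinearMap.proj_apply, LinearMap.single_apply]
    rw [← map_sum, Finset.univ_sum_single]
    exact LinearMap.congr_fun h x
  obtain ⟨i, hi⟩ := local_sum hM Finset.univ
    (fun i => ((r ∘ₗ LinearMap.single A N i) ∘ₗ (LinearMap.proj i ∘ₗ s) : Module.End A M))
    (by rw [h1]; exact isUnit_one)
  exact ⟨i, iso_of_isUnit hM.1 (hN i) _ _ hi⟩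

/-- Induction along decompositions into indecomposables. -/
theorem decomp_induction (Cls Pred : ModuleCat.{0} A → Prop)
    (hsum : ∀ X Y Z : ModuleCat.{0} A, (↑X ≃ₗ[A] (↑Y × ↑Z)) → Cls X → Cls Y ∧ Cls Z)
    (hprod : ∀ X Y Z : ModuleCat.{0} A, (↑X ≃ₗ[A] (↑Y × ↑Z)) → Pred Y → Pred Z → Pred X)
    (hzero : ∀ X : ModuleCat.{0} A, Subsingleton X → Pred X)
    (hindec : ∀ X : ModuleCat.{0} A, Module.Finite A X → Indec A X → Cls X → Pred X)
    (X : ModuleCat.{0} A) (hfin : Module.Finite A X) (hX : Cls X) : Pred X := by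
  have key : ∀ (n : ℕ) (X : ModuleCat.{0} A), Module.Finite A X → Cls X →
      Module.length A X ≤ n → Pred X := by
    intro n
    induction n with
    | zero =>
      intro X _ _ h
      exact hzero X (Module.length_eq_zero_iff.1 (le_antisymm (by simpa using h) bot_le))
    | succ n ih =>
      intro X hf hX h
      by_cases hs : Subsingleton X
      · exact hzero X hs
      by_cases hi : Indec A X
      · exact hindec X hf hi hX
      have hi' : ∃ Y Z : ModuleCat.{0} A, Nonempty (↑X ≃ₗ[A] (↑Y × ↑Z)) ∧
          Nontrivial Y ∧ Nontrivial Z := by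
        by_contra hcon
        apply hi
        refine ⟨not_subsingleton_iff_nontrivial.1 hs, fun Y Z e => ?_⟩
        by_contra hc
        rw [not_or, not_subsingleton_iff_nontrivial, not_subsingleton_iff_nontrivial] at hc
        exact hcon ⟨Y, Z, e, hc.1, hc.2⟩
      obtain ⟨Y, Z, ⟨e⟩, hY, hZ⟩ := hi'
      haveI : Module.Finite A Y := Module.Finite.of_surjective
        (LinearMap.fst A Y Z ∘ₗ e.toLinearMap) (Prod.fst_surjective.comp e.surjective)
      haveI : Module.Finite A Z := Module.Finite.of_surjective
        (LinearMap.snd A Y Z ∘ₗ e.toLinearMap) (Prod.snd_surjective.comp e.surjective)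
      have hl := e.length_eq
      rw [Module.length_prod] at hl
      rw [hl] at h
      have pY : 0 < Module.length A Y := Module.length_pos
      have pZ : 0 < Module.length A Z := Module.length_pos
      obtain ⟨a, ha⟩ := ENat.ne_top_iff_exists.1 (Module.length_ne_top (R := A) (M := Y))
      obtain ⟨b, hb⟩ := ENat.ne_top_iff_exists.1 (Module.length_ne_top (R := A) (M := Z))
      rw [← ha, ← hb] at h
      rw [← ha] at pY
      rw [← hb] at pZ
      norm_cast at h pY pZ
      obtain ⟨cY, cZ⟩ := hsum X Y Z e hX
      refine hprod X Y Z e (ih Y inferInstance cY ?_) (ih Z inferInstance cZ ?_)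
      · rw [← ha]; norm_cast; omega
      · rw [← hb]; norm_cast; omega
  obtain ⟨a, ha⟩ := ENat.ne_top_iff_exists.1 (Module.length_ne_top (R := A) (M := X))
  exact key a X hfin hX ha.ge

end krullSchmidt

section homological
variable {K A T : Type} [Field K] [Ring A] [Algebra K A]

theorem exists_desc {A M N L : Type} [Ring A] [AddCommGroup M] [Module A M] [AddCommGroup N]
    [Module A N] [AddCommGroup L] [Module A L] (p : M →ₗ[A] N) (hp : Surjective p)
    (k : M →ₗ[A] L) (hk : ∀ x, p x = 0 → k x = 0) : ∃ l : N →ₗ[A] L, l ∘ₗ p = k := by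
  refine ⟨(LinearMap.ker p).liftQ k hk ∘ₗ (p.quotKerEquivOfSurjective hp).symm.toLinearMap, ?_⟩
  ext x
  have : (p.quotKerEquivOfSurjective hp).symm (p x) = (LinearMap.ker p).mkQ x := by
    rw [LinearEquiv.symm_apply_eq]
    rfl
  simp only [LinearMap.comp_apply, LinearEquiv.coe_coe, this]
  exact (LinearMap.ker p).liftQ_apply k x

/-- The coinduced module `Hom_K(A, V)`. -/
def Coind (K A V : Type) [Field K] [Ring A] [Algebra K A] [AddCommGroup V] [Module K V] : Type :=
  A →ₗ[K] V

/-- The underlying `K`-linear map. -/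
def Coind.fn {V : Type} [AddCommGroup V] [Module K V] (f : Coind K A V) : A →ₗ[K] V := f

instance (V : Type) [AddCommGroup V] [Module K V] : AddCommGroup (Coind K A V) :=
  inferInstanceAs (AddCommGroup (A →ₗ[K] V))

instance (V : Type) [AddCommGroup V] [Module K V] : Module A (Coind K A V) where
  smul a f := f.fn ∘ₗ LinearMap.mulRight K a
  one_smul f := by
    apply LinearMap.ext; intro x
    exact congrArg f.fn (mul_one x)
  mul_smul a b f := by
    apply LinearMap.ext; intro x
    exact congrArg f.fn (mul_assoc x a b).symm
  smul_zero a := by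
    apply LinearMap.ext; intro x; rfl
  smul_add a f g := by
    apply LinearMap.ext; intro x; rfl
  add_smul a b f := by
    apply LinearMap.ext; intro x
    exact (congrArg f.fn (mul_add x a b)).trans (map_add f.fn _ _)
  zero_smul f := by
    apply LinearMap.ext; intro x
    exact (congrArg f.fn (mul_zero x)).trans (map_zero f.fn)

/-- The map `M → Hom_K(A, V)` adjoint to a `K`-linear map `M → V`. -/
def toCoind {M V : Type} [AddCommGroup M] [Module A M] [Module K M] [IsScalarTower K A M]
    [AddCommGroup V] [Module K V] (G : M →ₗ[K] V) : M →ₗ[A] Coind K A V where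
  toFun m := G ∘ₗ (LinearMap.toSpanSingleton A M m).restrictScalars K
  map_add' m m' := by
    apply LinearMap.ext; intro x
    change G (x • (m + m')) = G (x • m) + G (x • m')
    rw [smul_add, map_add]
  map_smul' a m := by
    apply LinearMap.ext; intro x
    change G (x • (a • m)) = G ((x * a) • m)
    rw [mul_smul]

theorem coind_gen [AddCommGroup T] [Module A T] [Module K T] [IsScalarTower K A T]
    [FiniteDimensional K T] (hfaithful : ∀ a : A, (∀ t : T, a • t = 0) → a = 0)
    (V : Type) [AddCommGroup V] [Module K V] [FiniteDimensional K V] :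
    Gen A T (Coind K A V) := by
  let b := Module.finBasis K (T →ₗ[K] V)
  let p : (Fin (Module.finrank K (T →ₗ[K] V)) → T) →ₗ[A] Coind K A V :=
    ∑ i, toCoind (b i) ∘ₗ LinearMap.proj i
  refine ⟨_, p, ?_⟩
  have hp : ∀ (G : T →ₗ[K] V) (t : T), toCoind (A := A) G t ∈ LinearMap.range p := by
    intro G t
    refine ⟨fun i => (b.repr G i) • t, ?_⟩
    apply LinearMap.ext
    intro x
    have h1 : (p fun i => (b.repr G i) • t)
        = ∑ i, toCoind (A := A) (b i) ((b.repr G i) • t) := by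
      simp [p, LinearMap.sum_apply]
    have h2 : ∀ (f : Fin (Module.finrank K (T →ₗ[K] V)) → (A →ₗ[K] V)),
        (∑ i, f i) x = ∑ i, f i x := fun f => LinearMap.sum_apply _ _ _
    rw [h1]
    refine (h2 _).trans ?_
    change ∑ i, b i (x • (b.repr G i • t)) = G (x • t)
    conv_rhs => rw [← b.sum_repr G]
    rw [LinearMap.sum_apply]
    refine Finset.sum_congr rfl fun i _ => ?_
    rw [smul_comm, map_smul, LinearMap.smul_apply]
  intro g
  let c := Module.finBasis K T
  let ι : A →ₗ[K] (Fin (Module.finrank K T) → T) :=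
    LinearMap.pi fun i => (LinearMap.toSpanSingleton A T (c i)).restrictScalars K
  have hι : Injective ι := by
    rw [← LinearMap.ker_eq_bot, LinearMap.ker_eq_bot']
    intro a ha
    apply hfaithful
    intro t
    have h1 : ∀ i, a • c i = 0 := fun i => congrFun ha i
    rw [← c.sum_repr t, Finset.smul_sum]
    refine Finset.sum_eq_zero fun i _ => ?_
    rw [smul_comm, h1, smul_zero]
  obtain ⟨r, hr⟩ := LinearMap.exists_leftInverse_of_injective ι (LinearMap.ker_eq_bot.2 hι)
  let G : (Fin (Module.finrank K T) → T) →ₗ[K] V := g.fn ∘ₗ r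
  have hG : g = ∑ i, toCoind (A := A) (G ∘ₗ LinearMap.single K (fun _ => T) i) (c i) := by
    apply LinearMap.ext
    intro x
    have h2 : ∀ (f : Fin (Module.finrank K T) → (A →ₗ[K] V)),
        (∑ i, f i) x = ∑ i, f i x := fun f => LinearMap.sum_apply _ _ _
    refine Eq.trans ?_ (h2 _).symm
    change g.fn x = ∑ i, G (Pi.single i (x • c i))
    rw [← map_sum]
    have h3 : (∑ i, Pi.single i (x • c i)) = ι x := Finset.univ_sum_single (ι x)
    rw [h3]
    exact congrArg g.fn (LinearMap.congr_fun hr x).symm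
  have : g ∈ LinearMap.range p := by
    rw [hG]
    exact Submodule.sum_mem _ fun i _ => hp _ _
  exact this

variable [FiniteDimensional K A] [AddCommGroup T] [Module A T] [Module K T] [IsScalarTower K A T]
    [FiniteDimensional K T]

/-- Relatively projective modules have projective dimension at most one. -/
theorem ker_projective (K : Type) [Field K] [Algebra K A] [FiniteDimensional K A]
    [Module K T] [IsScalarTower K A T] [FiniteDimensional K T] [IsNoetherianRing A]
    (hfaithful : ∀ a : A, (∀ t : T, a • t = 0) → a = 0)
    {X P : Type} [AddCommGroup X] [Module A X] [AddCommGroup P] [Module A P]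
    [Module.Finite A P] [Module.Projective A P] (hX : ExtP A T X) (p : P →ₗ[A] X)
    (hp : Surjective p) : Module.Projective A (LinearMap.ker p) := by
  obtain ⟨n, π, hπ⟩ := Module.Finite.exists_fin' A (LinearMap.ker p)
  let Y := LinearMap.ker π
  haveI : FiniteDimensional K Y := Module.Finite.trans A Y
  let Ysub : Y →ₗ[A] (Fin n → A) := Y.subtype
  obtain ⟨φ, hφ⟩ := LinearMap.exists_leftInverse_of_injective (Ysub.restrictScalars K)
    (LinearMap.ker_eq_bot.2 Subtype.val_injective)
  have hφ' : ∀ y : Y, φ (y : Fin n → A) = y := LinearMap.congr_fun hφ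
  let e0 : Y →ₗ[A] Coind K A Y := toCoind (LinearMap.id : Y →ₗ[K] Y)
  let e : (Fin n → A) →ₗ[A] Coind K A Y := toCoind φ
  have he0 : Injective e0 := by
    intro y y' h
    have := LinearMap.congr_fun (show (e0 y : A →ₗ[K] Y) = e0 y' from h) 1
    change (1 : A) • y = (1 : A) • y' at this
    simpa using this
  have hee : ∀ y : Y, e y = e0 y := by
    intro y
    apply LinearMap.ext
    intro x
    exact hφ' (x • y)
  let R := LinearMap.range e0
  have hI : Gen A T (Coind K A Y ⧸ R) :=
    (coind_gen hfaithful Y).quot R.mkQ R.mkQ_surjective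
  obtain ⟨f, hf⟩ := exists_desc π hπ (R.mkQ ∘ₗ e) (by
    intro x hx
    apply (Submodule.Quotient.mk_eq_zero R).2
    exact ⟨⟨x, hx⟩, (hee ⟨x, hx⟩).symm⟩)
  obtain ⟨h, hh⟩ := hX.extend hI (LinearMap.ker p).subtype p Subtype.val_injective hp
    (Submodule.range_subtype _) f
  obtain ⟨h', hh'⟩ := Module.projective_lifting_property R.mkQ h R.mkQ_surjective
  let d : (Fin n → A) →ₗ[A] Coind K A Y := e - h' ∘ₗ (LinearMap.ker p).subtype ∘ₗ π
  have hd : ∀ x, d x ∈ R := by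
    intro x
    apply (Submodule.Quotient.mk_eq_zero R).1
    have h1 := LinearMap.congr_fun hf x
    have h2 := LinearMap.congr_fun hh (π x)
    have h3 := LinearMap.congr_fun hh' (π x : P)
    change R.mkQ (d x) = 0
    simp only [LinearMap.comp_apply] at h1 h2 h3
    rw [Submodule.subtype_apply] at h2
    simp only [d, LinearMap.sub_apply, LinearMap.comp_apply, map_sub,
      Submodule.subtype_apply]
    rw [h3, h2, h1, sub_self]
  let ε := LinearEquiv.ofInjective e0 he0
  let r : (Fin n → A) →ₗ[A] Y := ε.symm.toLinearMap ∘ₗ d.codRestrict R hd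
  have hr : ∀ y : Y, r y = y := by
    intro y
    change ε.symm (d.codRestrict R hd y) = y
    rw [LinearEquiv.symm_apply_eq]
    apply Subtype.ext
    change d y = e0 y
    have : π y = 0 := y.2
    simp [d, this, hee]
  obtain ⟨σ, hσ⟩ := exists_desc π hπ (LinearMap.id - Y.subtype ∘ₗ r) (by
    intro x hx
    have := hr ⟨x, hx⟩
    simp only [LinearMap.sub_apply, LinearMap.id_apply, LinearMap.comp_apply]
    rw [this]
    simp)
  refine Module.Projective.of_split σ π ?_
  ext1 w
  obtain ⟨x, rfl⟩ := hπ w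
  have h1 := LinearMap.congr_fun hσ x
  simp only [LinearMap.comp_apply] at h1
  have h2 : π (r x : Fin n → A) = 0 := (r x).2
  simp only [LinearMap.comp_apply, h1, LinearMap.sub_apply, map_sub, LinearMap.id_apply]
  simp [h2]

theorem finite_hom (K : Type) [Field K] [Algebra K A] {M X : Type} [AddCommGroup M] [Module A M]
    [Module K M] [IsScalarTower K A M] [FiniteDimensional K M] [AddCommGroup X] [Module A X]
    [Module K X] [IsScalarTower K A X] [FiniteDimensional K X] :
    FiniteDimensional K (M →ₗ[A] X) :=
  Module.Finite.of_injective (LinearMap.restrictScalarsₗ K A M X K)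
    (LinearMap.restrictScalars_injective K)

/-- Left `add T`-approximations of projectives. -/
theorem approx (K : Type) [Field K] [Algebra K A] [FiniteDimensional K A]
    [Module K T] [IsScalarTower K A T] [FiniteDimensional K T]
    (hfaithful : ∀ a : A, (∀ t : T, a • t = 0) → a = 0) (hT : ExtP A T T)
    {P : Type} [AddCommGroup P] [Module A P] [Module.Finite A P] [Module.Projective A P] :
    ∃ (n : ℕ) (i : P →ₗ[A] (Fin n → T)), Injective i ∧
      ExtP A T ((Fin n → T) ⧸ LinearMap.range i) := by
  letI : Module K P := Module.compHom P (algebraMap K A)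
  haveI : IsScalarTower K A P := IsScalarTower.of_algebraMap_smul fun _ _ => rfl
  haveI : FiniteDimensional K P := Module.Finite.trans A P
  haveI : FiniteDimensional K (P →ₗ[A] T) := finite_hom K
  let b := Module.finBasis K (P →ₗ[A] T)
  let i : P →ₗ[A] (Fin (Module.finrank K (P →ₗ[A] T)) → T) := LinearMap.pi b
  have hfac : ∀ f : P →ₗ[A] T, ∃ g : (Fin (Module.finrank K (P →ₗ[A] T)) → T) →ₗ[A] T,
      g ∘ₗ i = f := by
    intro f
    refine ⟨∑ j, b.repr f j • LinearMap.proj j, ?_⟩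
    ext x
    have h1 := LinearMap.congr_fun (b.sum_repr f) x
    rw [LinearMap.sum_apply] at h1
    rw [← h1]
    simp [i, LinearMap.sum_apply]
  refine ⟨_, i, ?_, ?_⟩
  · rw [← LinearMap.ker_eq_bot, LinearMap.ker_eq_bot']
    intro x hx
    obtain ⟨m, f, g, -, hg, -⟩ := Module.Finite.exists_comp_eq_id_of_projective A P
    apply hg
    rw [map_zero]
    ext l
    apply hfaithful
    intro t
    obtain ⟨h, hh⟩ := hfac (LinearMap.toSpanSingleton A T t ∘ₗ LinearMap.proj l ∘ₗ g)
    have := LinearMap.congr_fun hh x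
    rw [LinearMap.comp_apply, hx, map_zero] at this
    exact this.symm
  · intro E C _ _ _ _ g hg hk q
    obtain ⟨l, hl⟩ := hT.pow _ E C g hg hk (q ∘ₗ (LinearMap.range i).mkQ)
    have hl' : ∀ x, g (l x) = q ((LinearMap.range i).mkQ x) := LinearMap.congr_fun hl
    have hqi : ∀ x, (LinearMap.range i).mkQ (i x) = 0 := fun x =>
      (Submodule.Quotient.mk_eq_zero _).2 ⟨x, rfl⟩
    let li : P →ₗ[A] LinearMap.ker g := (l ∘ₗ i).codRestrict _ (by
      intro x
      rw [LinearMap.mem_ker, LinearMap.comp_apply, hl', hqi, map_zero])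
    obtain ⟨m, s, hs⟩ := hk
    obtain ⟨w, hw⟩ := Module.projective_lifting_property s li hs
    choose v hv using fun j => hfac (LinearMap.proj j ∘ₗ w)
    let h := (LinearMap.ker g).subtype ∘ₗ s ∘ₗ LinearMap.pi v
    have hh : ∀ x, h (i x) = l (i x) := by
      intro x
      have h1 : LinearMap.pi v (i x) = w x := by
        ext j
        exact LinearMap.congr_fun (hv j) x
      change ((s (LinearMap.pi v (i x)) : LinearMap.ker g) : E) = l (i x)
      rw [h1]
      exact congrArg Subtype.val (LinearMap.congr_fun hw x)
    have hgh : ∀ x, g (h x) = 0 := fun x => (s (LinearMap.pi v x)).2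
    refine ⟨(LinearMap.range i).liftQ (l - h) ?_, ?_⟩
    · rintro _ ⟨x, rfl⟩
      rw [LinearMap.mem_ker, LinearMap.sub_apply, hh, sub_self]
    · apply Submodule.linearMap_qext
      refine LinearMap.ext fun x => ?_
      change g (l x - h x) = q _
      rw [map_sub, hl', hgh, sub_zero]

end homological

section multiplicity
variable {K A : Type} [Field K] [Ring A] [Algebra K A] [IsArtinianRing A] [IsNoetherianRing A]
variable {M : Type} [AddCommGroup M] [Module A M] [Module.Finite A M]

/-- Radical maps from an indecomposable module. -/
def radHom (K : Type) [Field K] [Algebra K A] (hM : Indec A M) (X : Type) [AddCommGroup X]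
    [Module A X] [Module K X] [IsScalarTower K A X] : Submodule K (M →ₗ[A] X) where
  carrier := {f | ∀ g : X →ₗ[A] M, ¬ IsUnit (g ∘ₗ f : Module.End A M)}
  zero_mem' := by
    intro g h
    have := hM.1
    rw [LinearMap.comp_zero] at h
    exact not_isUnit_zero h
  add_mem' := by
    intro a b ha hb g h
    rw [LinearMap.comp_add] at h
    rcases local_add hM _ _ h with h | h
    · exact ha g h
    · exact hb g h
  smul_mem' := by
    intro c f hf g h
    let s : X →ₗ[A] X := c • LinearMap.id
    apply hf (g ∘ₗ s)
    exact h

theorem mem_radHom (hM : Indec A M) {X : Type} [AddCommGroup X] [Module A X]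
    [Module K X] [IsScalarTower K A X] (f : M →ₗ[A] X) :
    f ∈ radHom K hM X ↔ ∀ g : X →ₗ[A] M, ¬ IsUnit (g ∘ₗ f : Module.End A M) := Iff.rfl

/-- The multiplicity function attached to an indecomposable module. -/
def muAux (K : Type) [Field K] [Algebra K A] (hM : Indec A M) (X : Type) [AddCommGroup X]
    [Module A X] [Module K X] [IsScalarTower K A X] : ℚ :=
  (Module.finrank K (M →ₗ[A] X) : ℚ) - Module.finrank K (radHom K hM X)

theorem muAux_congr (hM : Indec A M) {X Y : Type} [AddCommGroup X]
    [Module A X] [Module K X] [IsScalarTower K A X] [AddCommGroup Y]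
    [Module A Y] [Module K Y] [IsScalarTower K A Y] (e : X ≃ₗ[A] Y) :
    muAux K hM X = muAux K hM Y := by
  let E : (M →ₗ[A] X) ≃ₗ[K] (M →ₗ[A] Y) :=
    { toFun := fun f => e.toLinearMap ∘ₗ f
      invFun := fun f => e.symm.toLinearMap ∘ₗ f
      map_add' := fun f g => by ext; simp
      map_smul' := fun c f => by
        ext m
        exact LinearMap.map_smul_of_tower e.toLinearMap c (f m)
      left_inv := fun f => by ext; simp
      right_inv := fun f => by ext; simp }
  have hmap : radHom K hM Y = (radHom K hM X).map E.toLinearMap := by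
    ext f
    constructor
    · intro hf
      refine ⟨E.symm f, ?_, E.apply_symm_apply f⟩
      intro g hg
      exact hf (g ∘ₗ e.symm.toLinearMap) hg
    · rintro ⟨f, hf, rfl⟩ g hg
      exact hf (g ∘ₗ e.toLinearMap) hg
  rw [muAux, muAux, hmap, E.finrank_eq]
  congr 2
  exact (LinearEquiv.finrank_map_eq E _).symm

theorem muAux_prod (hM : Indec A M) {X Y : Type} [AddCommGroup X]
    [Module A X] [Module K X] [IsScalarTower K A X] [AddCommGroup Y]
    [Module A Y] [Module K Y] [IsScalarTower K A Y] [FiniteDimensional K (M →ₗ[A] X)]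
    [FiniteDimensional K (M →ₗ[A] Y)] :
    muAux K hM (X × Y) = muAux K hM X + muAux K hM Y := by
  let E : ((M →ₗ[A] X) × (M →ₗ[A] Y)) ≃ₗ[K] (M →ₗ[A] X × Y) := LinearMap.prodEquiv K
  have hmap : radHom K hM (X × Y) = ((radHom K hM X).prod (radHom K hM Y)).map E.toLinearMap := by
    ext f
    constructor
    · intro hf
      refine ⟨(LinearMap.fst A X Y ∘ₗ f, LinearMap.snd A X Y ∘ₗ f), ⟨?_, ?_⟩, ?_⟩
      · intro g hg
        exact hf (g ∘ₗ LinearMap.fst A X Y) hg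
      · intro g hg
        exact hf (g ∘ₗ LinearMap.snd A X Y) hg
      · rfl
    · rintro ⟨⟨f, f'⟩, ⟨hf, hf'⟩, rfl⟩ g hg
      have h1 : (g ∘ₗ (f.prod f') : Module.End A M) =
          (g ∘ₗ LinearMap.inl A X Y) ∘ₗ f + (g ∘ₗ LinearMap.inr A X Y) ∘ₗ f' := by
        ext m
        simp [← map_add]
      have hg' : IsUnit (g ∘ₗ (f.prod f') : Module.End A M) := hg
      rw [h1] at hg'
      rcases local_add hM _ _ hg' with h | h
      · exact hf _ h
      · exact hf' _ h
  let E2 : ((radHom K hM X).prod (radHom K hM Y)) ≃ₗ[K] (radHom K hM X × radHom K hM Y) :=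
    { toFun := fun f => (⟨f.1.1, f.2.1⟩, ⟨f.1.2, f.2.2⟩)
      invFun := fun f => ⟨(f.1.1, f.2.1), ⟨f.1.2, f.2.2⟩⟩
      map_add' := fun f g => rfl
      map_smul' := fun c f => rfl
      left_inv := fun f => rfl
      right_inv := fun f => rfl }
  have h1 : Module.finrank K (radHom K hM (X × Y)) =
      Module.finrank K (radHom K hM X) + Module.finrank K (radHom K hM Y) := by
    rw [hmap]
    refine (LinearEquiv.finrank_map_eq E _).trans ?_
    rw [E2.finrank_eq, Module.finrank_prod]
  rw [muAux, muAux, muAux, h1, ← E.finrank_eq, Module.finrank_prod]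
  push_cast
  ring

theorem muAux_eq_zero (hM : Indec A M) {X : Type} [AddCommGroup X]
    [Module A X] [Module K X] [IsScalarTower K A X] (hX : Indec A X)
    (h : IsEmpty (M ≃ₗ[A] X)) : muAux K hM X = 0 := by
  have : radHom K hM X = ⊤ := by
    rw [eq_top_iff]
    intro f _ g hg
    obtain ⟨e⟩ := iso_of_isUnit hM.1 hX f g hg
    exact h.false e
  rw [muAux, this, finrank_top, sub_self]

theorem muAux_self_ne (hM : Indec A M) [Module K M] [IsScalarTower K A M]
    [FiniteDimensional K (M →ₗ[A] M)] : muAux K hM M ≠ 0 := by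
  have h1 : radHom K hM M < ⊤ := by
    rw [lt_top_iff_ne_top]
    intro h
    have : (LinearMap.id : M →ₗ[A] M) ∈ radHom K hM M := h ▸ Submodule.mem_top
    exact this LinearMap.id isUnit_one
  have h2 := Submodule.finrank_lt h1.ne
  rw [muAux, sub_ne_zero]
  exact_mod_cast h2.ne'

/-- The multiplicity function without choosing a `K`-structure. -/
def mu (K : Type) [Field K] [Algebra K A] (hM : Indec A M) (X : Type) [AddCommGroup X]
    [Module A X] : ℚ :=
  letI : Module K X := Module.compHom X (algebraMap K A)
  haveI : IsScalarTower K A X := IsScalarTower.of_algebraMap_smul fun _ _ => rfl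
  muAux K hM X

theorem mu_congr (hM : Indec A M) {X Y : Type} [AddCommGroup X]
    [Module A X] [AddCommGroup Y] [Module A Y] (e : X ≃ₗ[A] Y) :
    mu K hM X = mu K hM Y := by
  letI : Module K X := Module.compHom X (algebraMap K A)
  haveI : IsScalarTower K A X := IsScalarTower.of_algebraMap_smul fun _ _ => rfl
  letI : Module K Y := Module.compHom Y (algebraMap K A)
  haveI : IsScalarTower K A Y := IsScalarTower.of_algebraMap_smul fun _ _ => rfl
  exact muAux_congr hM e

theorem finite_hom' (K : Type) [Field K] [Algebra K A] [FiniteDimensional K A] {X : Type}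
    [AddCommGroup X] [Module A X] [Module.Finite A X]
    [Module K X] [IsScalarTower K A X] : FiniteDimensional K (M →ₗ[A] X) := by
  letI : Module K M := Module.compHom M (algebraMap K A)
  haveI : IsScalarTower K A M := IsScalarTower.of_algebraMap_smul fun _ _ => rfl
  haveI : FiniteDimensional K X := Module.Finite.trans A X
  haveI : FiniteDimensional K M := Module.Finite.trans A M
  exact finite_hom K

theorem mu_prod [FiniteDimensional K A] (hM : Indec A M) {X Y : Type} [AddCommGroup X]
    [Module A X] [Module.Finite A X] [AddCommGroup Y] [Module A Y] [Module.Finite A Y] :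
    mu K hM (X × Y) = mu K hM X + mu K hM Y := by
  letI : Module K X := Module.compHom X (algebraMap K A)
  haveI : IsScalarTower K A X := IsScalarTower.of_algebraMap_smul fun _ _ => rfl
  letI : Module K Y := Module.compHom Y (algebraMap K A)
  haveI : IsScalarTower K A Y := IsScalarTower.of_algebraMap_smul fun _ _ => rfl
  haveI : FiniteDimensional K (M →ₗ[A] X) := finite_hom' K
  haveI : FiniteDimensional K (M →ₗ[A] Y) := finite_hom' K
  have h := muAux_prod (K := K) hM (X := X) (Y := Y)
  exact h

theorem mu_eq_zero (hM : Indec A M) {X : Type} [AddCommGroup X]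
    [Module A X] (hX : Indec A X) (h : IsEmpty (M ≃ₗ[A] X)) : mu K hM X = 0 := by
  letI : Module K X := Module.compHom X (algebraMap K A)
  haveI : IsScalarTower K A X := IsScalarTower.of_algebraMap_smul fun _ _ => rfl
  exact muAux_eq_zero hM hX h

theorem mu_self_ne [FiniteDimensional K A] (hM : Indec A M) : mu K hM M ≠ 0 := by
  letI : Module K M := Module.compHom M (algebraMap K A)
  haveI : IsScalarTower K A M := IsScalarTower.of_algebraMap_smul fun _ _ => rfl
  haveI : FiniteDimensional K (M →ₗ[A] M) := finite_hom' K
  exact muAux_self_ne hM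

theorem mu_subsingleton [FiniteDimensional K A] (hM : Indec A M) {X : Type} [AddCommGroup X]
    [Module A X] [Subsingleton X] : mu K hM X = 0 := by
  have e : X ≃ₗ[A] (X × X) := LinearEquiv.ofSubsingleton X (X × X)
  have h := mu_congr (K := K) hM e
  rw [mu_prod] at h
  linarith

end multiplicity

section main
variable {A : Type} [Ring A]

theorem retract_of_pi {T : Type} [AddCommGroup T] [Module A T] {ι : Type} (N : ι → Type)
    [∀ i, AddCommGroup (N i)] [∀ i, Module A (N i)] (e : T ≃ₗ[A] (∀ i, N i)) (i : ι) :
    ∃ (s : N i →ₗ[A] T) (r : T →ₗ[A] N i), r ∘ₗ s = LinearMap.id := by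
  classical
  refine ⟨e.symm.toLinearMap ∘ₗ LinearMap.single A N i, LinearMap.proj i ∘ₗ e.toLinearMap, ?_⟩
  ext x
  simp

theorem span_contra {ι κ : Type} [Fintype ι] [Fintype κ] [DecidableEq κ]
    (hc : Fintype.card ι < Fintype.card κ) (v : ι → (κ → ℚ)) (w : κ → (κ → ℚ))
    (hw0 : ∀ j, w j j ≠ 0) (hw : ∀ i j, i ≠ j → w i j = 0)
    (hs : ∀ j, w j ∈ Submodule.span ℚ (Set.range v)) : False := by
  have htop : Submodule.span ℚ (Set.range v) = ⊤ := by
    rw [eq_top_iff]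
    intro x _
    rw [← Finset.univ_sum_single x]
    refine Submodule.sum_mem _ fun j _ => ?_
    have : Pi.single j (x j) = (x j / w j j) • w j := by
      ext l
      by_cases h : j = l
      · subst h
        simp [hw0]
      · simp [hw j l h, Pi.single_eq_of_ne (Ne.symm h)]
    rw [this]
    exact Submodule.smul_mem _ _ (hs j)
  have h1 := finrank_range_le_card (R := ℚ) v
  rw [Set.finrank, htop, finrank_top, Module.finrank_fintype_fun_eq_card] at h1
  omega

theorem indec_iso (K : Type) [Field K] [Algebra K A] [FiniteDimensional K A] [IsArtinianRing A]
    [IsNoetherianRing A] {T : Type} [AddCommGroup T] [Module A T] [Module.Finite A T]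
    (hfaithful : ∀ a : A, (∀ t : T, a • t = 0) → a = 0) (hT : ExtP A T T)
    {k : ℕ} (M : Fin k → ModuleCat.{0} A)
    (hM : ∀ i, Indec A (M i)) (hMM : ∀ i j, i ≠ j → IsEmpty (↑(M i) ≃ₗ[A] ↑(M j)))
    (hMG : ∀ i, Gen A T (M i)) (hME : ∀ i, ExtP A T (M i)) (hA : HasIndecCount A A k)
    (N : ModuleCat.{0} A) (hN : Indec A N) (hNG : Gen A T N) (hNE : ExtP A T N) :
    ∃ i, Nonempty (N ≃ₗ[A] M i) := by
  classical
  letI : Module K T := Module.compHom T (algebraMap K A)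
  haveI : IsScalarTower K A T := IsScalarTower.of_algebraMap_smul fun _ _ => rfl
  haveI : FiniteDimensional K T := Module.Finite.trans A T
  by_contra hcon
  have hcon' : ∀ i, IsEmpty (N ≃ₗ[A] M i) := fun i => by
    rw [← not_nonempty_iff]
    exact fun h => hcon ⟨i, h⟩
  let W : Option (Fin k) → ModuleCat.{0} A := fun o => o.elim N M
  have hW : ∀ j, Indec A (W j) := by
    rintro (_ | i)
    · exact hN
    · exact hM i
  have hWG : ∀ j, Gen A T (W j) := by
    rintro (_ | i)
    · exact hNG
    · exact hMG i
  have hWE : ∀ j, ExtP A T (W j) := by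
    rintro (_ | i)
    · exact hNE
    · exact hME i
  have hWW : ∀ i j, i ≠ j → IsEmpty (W i ≃ₗ[A] W j) := by
    rintro (_ | i) (_ | j) hij
    · exact absurd rfl hij
    · exact hcon' j
    · exact ⟨fun e => (hcon' i).false e.symm⟩
    · exact hMM i j (fun h => hij (by rw [h]))
  haveI hWF : ∀ j, Module.Finite A (W j) := fun j => (hWG j).finite
  let vec : ModuleCat.{0} A → (Option (Fin k) → ℚ) := fun X j => mu K (hW j) X
  have hvec_prod : ∀ X Y Z : ModuleCat.{0} A, Module.Finite A Y → Module.Finite A Z →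
      (X ≃ₗ[A] (Y × Z)) → vec X = vec Y + vec Z := by
    intro X Y Z _ _ e
    ext j
    exact (mu_congr (hW j) e).trans (mu_prod (hW j))
  obtain ⟨P, m, hP, hm, -, ⟨eA⟩⟩ := hA
  let eA' : A ≃ₗ[A] (∀ x : (Σ i : Fin k, Fin (m i)), P x.1) :=
    eA.trans (LinearEquiv.piCurry A (fun (i : Fin k) (_ : Fin (m i)) => (P i : Type))).symm
  have hPret : ∀ i, ∃ (s : P i →ₗ[A] A) (r : A →ₗ[A] P i), r ∘ₗ s = LinearMap.id :=
    fun i => retract_of_pi (fun x : (Σ i : Fin k, Fin (m i)) => (P x.1 : Type)) eA' ⟨i, 0, hm i⟩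
  have hPfin : ∀ i, Module.Finite A (P i) := fun i => by
    obtain ⟨s, r, h⟩ := hPret i
    exact Module.Finite.of_surjective r fun x => ⟨s x, LinearMap.congr_fun h x⟩
  have hPproj : ∀ i, Module.Projective A (P i) := fun i => by
    obtain ⟨s, r, h⟩ := hPret i
    exact Module.Projective.of_split s r h
  -- coresolutions of the indecomposable projectives
  choose n ι hι hιE using fun i => approx (P := P i) K hfaithful hT
  let U0 : Fin k → ModuleCat.{0} A := fun i => ModuleCat.of A (Fin (n i) → T)
  let U1 : Fin k → ModuleCat.{0} A := fun i =>
    ModuleCat.of A ((Fin (n i) → T) ⧸ LinearMap.range (ι i))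
  let v : Fin k → (Option (Fin k) → ℚ) := fun i => vec (U0 i) - vec (U1 i)
  let S := Submodule.span ℚ (Set.range v)
  let Good : ModuleCat.{0} A → Prop := fun Q => ∃ (V0 V1 : ModuleCat.{0} A) (i : Q →ₗ[A] V0)
    (q : V0 →ₗ[A] V1), Gen A T V0 ∧ Gen A T V1 ∧ ExtP A T V1 ∧ Injective i ∧ Surjective q ∧
      LinearMap.range i = LinearMap.ker q ∧ vec V0 - vec V1 ∈ S
  have hgood : ∀ Q : ModuleCat.{0} A, Module.Finite A Q → Module.Projective A Q → Good Q := by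
    refine decomp_induction (fun Q => Module.Projective A Q) Good ?_ ?_ ?_ ?_
    · intro X Y Z e hX
      constructor
      · exact Module.Projective.of_split (e.symm.toLinearMap ∘ₗ LinearMap.inl A Y Z)
          (LinearMap.fst A Y Z ∘ₗ e.toLinearMap) (by ext; simp)
      · exact Module.Projective.of_split (e.symm.toLinearMap ∘ₗ LinearMap.inr A Y Z)
          (LinearMap.snd A Y Z ∘ₗ e.toLinearMap) (by ext; simp)
    · rintro X Y Z e ⟨V0, V1, i, q, h1, h2, h3, h4, h5, h6, h7⟩
        ⟨V0', V1', i', q', h1', h2', h3', h4', h5', h6', h7'⟩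
      refine ⟨ModuleCat.of A (V0 × V0'), ModuleCat.of A (V1 × V1'),
        i.prodMap i' ∘ₗ e.toLinearMap, q.prodMap q', h1.prod h1', h2.prod h2', h3.prod h3',
        (h4.prodMap h4').comp e.injective, h5.prodMap h5', ?_, ?_⟩
      · change LinearMap.range (i.prodMap i' ∘ₗ e.toLinearMap) = LinearMap.ker (q.prodMap q')
        rw [LinearMap.range_comp, LinearEquiv.range, Submodule.map_top, LinearMap.range_prodMap,
          LinearMap.ker_prodMap, h6, h6']
      · rw [hvec_prod (ModuleCat.of A (V0 × V0')) V0 V0' h1.finite h1'.finite (LinearEquiv.refl A _),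
          hvec_prod (ModuleCat.of A (V1 × V1')) V1 V1' h2.finite h2'.finite (LinearEquiv.refl A _), add_sub_add_comm]
        exact S.add_mem h7 h7'
    · intro X hX
      refine ⟨ModuleCat.of A PUnit, ModuleCat.of A PUnit, 0, 0, ⟨0, 0, ?_⟩, ⟨0, 0, ?_⟩, ?_, ?_,
        ?_, ?_, ?_⟩
      · intro x; exact ⟨0, rfl⟩
      · intro x; exact ⟨0, rfl⟩
      · intro E C _ _ _ _ g _ _ q
        refine ⟨0, ?_⟩
        ext x
        have hx : x = 0 := rfl
        rw [hx, map_zero, map_zero]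
      · intro x y _; exact Subsingleton.elim _ _
      · intro x; exact ⟨0, rfl⟩
      · ext x
        constructor
        · intro _; rfl
        · intro _; exact ⟨0, rfl⟩
      · rw [sub_self]; exact S.zero_mem
    · intro Q hQf hQ hQP
      obtain ⟨l, f, g, -, -, hfg⟩ := Module.Finite.exists_comp_eq_id_of_projective A Q
      let eF : (Fin l → A) ≃ₗ[A] (∀ y : (Σ _ : Fin l, (Σ i : Fin k, Fin (m i))), P y.2.1) :=
        (LinearEquiv.piCongrRight (fun _ : Fin l => eA')).trans
          (LinearEquiv.piCurry A
            (fun (_ : Fin l) (x : (Σ i : Fin k, Fin (m i))) => (P x.1 : Type))).symm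
      obtain ⟨y, ⟨ε⟩⟩ := iso_of_retract_pi hQ
        (fun y : (Σ _ : Fin l, (Σ i : Fin k, Fin (m i))) => (P y.2.1 : Type))
        (fun y => hP _) (eF.toLinearMap ∘ₗ g) (f ∘ₗ eF.symm.toLinearMap) (by
          rw [← hfg]; ext x; simp)
      refine ⟨U0 y.2.1, U1 y.2.1, ι y.2.1 ∘ₗ ε.toLinearMap, (LinearMap.range (ι y.2.1)).mkQ,
        Gen.pow _, (Gen.pow _).quot _ (Submodule.mkQ_surjective _), hιE _,
        (hι _).comp ε.injective, Submodule.mkQ_surjective _, ?_,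
        Submodule.subset_span ⟨y.2.1, rfl⟩⟩
      change LinearMap.range (ι y.2.1 ∘ₗ ε.toLinearMap) =
        LinearMap.ker (LinearMap.range (ι y.2.1)).mkQ
      rw [LinearMap.range_comp, LinearEquiv.range, Submodule.map_top, Submodule.ker_mkQ]
  have hmem : ∀ X : ModuleCat.{0} A, Gen A T X → ExtP A T X → vec X ∈ S := by
    intro X hXG hXE
    haveI : Module.Finite A X := hXG.finite
    obtain ⟨l, p, hp⟩ := Module.Finite.exists_fin' A X
    haveI := ker_projective K hfaithful hXE p hp
    obtain ⟨V0, V1, i, q, h1, h2, h3, h4, h5, h6, h7⟩ :=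
      hgood (ModuleCat.of A (Fin l → A)) (inferInstanceAs (Module.Finite A (Fin l → A)))
        (inferInstanceAs (Module.Projective A (Fin l → A)))
    obtain ⟨V0', V1', i', q', h1', h2', h3', h4', h5', h6', h7'⟩ :=
      hgood (ModuleCat.of A (LinearMap.ker p))
        (inferInstanceAs (Module.Finite A (LinearMap.ker p))) this
    obtain ⟨e⟩ := key_iso hXG hXE h1 h1' h3 h3' p hp i q h4 h5 h6 i' q' h4' h5' h6'
    have hf0 := h1.finite
    have hf1 := h2.finite
    have hf0' := h1'.finite
    have hf1' := h2'.finite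
    have E1 := hvec_prod (ModuleCat.of A (V0 × V1')) V0' (ModuleCat.of A (X × V1)) hf0'
      (inferInstanceAs (Module.Finite A (X × V1))) e
    rw [hvec_prod (ModuleCat.of A (V0 × V1')) V0 V1' hf0 hf1' (LinearEquiv.refl A _),
      hvec_prod (ModuleCat.of A (X × V1)) X V1 hXG.finite hf1 (LinearEquiv.refl A _)] at E1
    have : vec X = (vec V0 - vec V1) - (vec V0' - vec V1') := by
      rw [sub_sub_eq_add_sub, eq_sub_iff_add_eq, sub_add_eq_add_sub, eq_sub_iff_add_eq, E1]
      abel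
    rw [this]
    exact S.sub_mem h7 h7'
  refine span_contra (κ := Option (Fin k)) (by simp) v (fun j => vec (W j)) ?_ ?_ ?_
  · intro j
    exact mu_self_ne (hW j)
  · intro i j hij
    exact mu_eq_zero (hW j) (hW i) (hWW j i (Ne.symm hij))
  · intro j
    exact hmem (W j) (hWG j) (hWE j)

theorem inAdd_of_extP (K : Type) [Field K] [Algebra K A] [FiniteDimensional K A]
    [IsArtinianRing A] [IsNoetherianRing A] {T : Type} [AddCommGroup T] [Module A T]
    [Module.Finite A T]
    (hfaithful : ∀ a : A, (∀ t : T, a • t = 0) → a = 0) (hT : ExtP A T T)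
    {k : ℕ} (hTk : HasIndecCount A T k) (hA : HasIndecCount A A k)
    (C : ModuleCat.{0} A) (hCG : Gen A T C) (hCE : ExtP A T C) : InAdd A T C := by
  obtain ⟨M, m, hM, hm, hMM, ⟨e⟩⟩ := hTk
  let e' : T ≃ₗ[A] (∀ x : (Σ i : Fin k, Fin (m i)), M x.1) :=
    e.trans (LinearEquiv.piCurry A (fun (i : Fin k) (_ : Fin (m i)) => (M i : Type))).symm
  have hret : ∀ i, ∃ (s : M i →ₗ[A] T) (r : T →ₗ[A] M i), r ∘ₗ s = LinearMap.id :=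
    fun i => retract_of_pi (fun x : (Σ i : Fin k, Fin (m i)) => (M x.1 : Type)) e' ⟨i, 0, hm i⟩
  have hMG : ∀ i, Gen A T (M i) := fun i => by
    obtain ⟨s, r, h⟩ := hret i
    exact Gen.self.quot r fun x => ⟨s x, LinearMap.congr_fun h x⟩
  have hME : ∀ i, ExtP A T (M i) := fun i => by
    obtain ⟨s, r, h⟩ := hret i
    exact hT.of_retract s r h
  refine decomp_induction (fun X => Gen A T X ∧ ExtP A T X) (fun X => InAdd A T X)
    ?_ ?_ ?_ ?_ C hCG.finite ⟨hCG, hCE⟩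
  · rintro X Y Z e ⟨hG, hE⟩
    refine ⟨⟨hG.quot (LinearMap.fst A Y Z ∘ₗ e.toLinearMap)
      (Prod.fst_surjective.comp e.surjective),
      hE.of_retract (e.symm.toLinearMap ∘ₗ LinearMap.inl A Y Z)
          (LinearMap.fst A Y Z ∘ₗ e.toLinearMap) (by ext; simp)⟩,
      ⟨hG.quot (LinearMap.snd A Y Z ∘ₗ e.toLinearMap)
      (Prod.snd_surjective.comp e.surjective),
      hE.of_retract (e.symm.toLinearMap ∘ₗ LinearMap.inr A Y Z)
          (LinearMap.snd A Y Z ∘ₗ e.toLinearMap) (by ext; simp)⟩⟩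
  · rintro X Y Z e ⟨a, Y', ⟨f⟩⟩ ⟨b, Z', ⟨g⟩⟩
    refine ⟨a + b, ModuleCat.of A (Y' × Z'), ⟨?_⟩⟩
    have e1 : (X × (Y' × Z')) ≃ₗ[A] ((Y × Z) × (Y' × Z')) :=
      LinearEquiv.prodCongr e (LinearEquiv.refl A _)
    have e2 : ((Y × Z) × (Y' × Z')) ≃ₗ[A] ((Y × Y') × (Z × Z')) :=
      LinearEquiv.prodProdProdComm A Y Z Y' Z'
    have e3 : ((Y × Y') × (Z × Z')) ≃ₗ[A] ((Fin a → T) × (Fin b → T)) :=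
      LinearEquiv.prodCongr f g
    have e4 := (LinearEquiv.sumArrowLequivProdArrow (Fin a) (Fin b) A T).symm
    have e5 := LinearEquiv.funCongrLeft A T (finSumFinEquiv (m := a) (n := b)).symm
    exact e1.trans (e2.trans (e3.trans (e4.trans e5)))
  · intro X hX
    refine ⟨0, ModuleCat.of A PUnit, ⟨?_⟩⟩
    exact LinearEquiv.ofSubsingleton (X × PUnit) (Fin 0 → T)
  · rintro X hXf hX ⟨hG, hE⟩
    obtain ⟨i, ⟨ε⟩⟩ := indec_iso K hfaithful hT M hM hMM hMG hME hA X hX hG hE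
    obtain ⟨s, r, h⟩ := hret i
    refine ⟨1, ModuleCat.of A (LinearMap.ker r), ⟨?_⟩⟩
    have e1 : (X × LinearMap.ker r) ≃ₗ[A] (M i × LinearMap.ker r) :=
      LinearEquiv.prodCongr ε (LinearEquiv.refl A _)
    exact e1.trans ((splitEquiv s r h).symm.trans (LinearEquiv.funUnique (Fin 1) A T).symm)

end main

/-- Let `A` be a finite dimensional algebra and `T` a finitely
generated module such that `Gen T` is a torsion class and `T` is Ext-projective in
`Gen T` (equivalently, by the Auslander–Smalø criterion, `T` is `τ`-rigid).  If `T` is a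
faithful `τ`-tilting module (i.e. in addition `|T| = |A|`), then `T` is a tilting
module. -/
theorem faithful_tau_tilting_is_tilting
    (K A : Type) [Field K] [IsAlgClosed K] [Ring A] [Algebra K A] [FiniteDimensional K A]
    (T : Type) [AddCommGroup T] [Module A T] [Module.Finite A T]
    (htors_quot : ∀ X Y : ModuleCat.{0} A, ∀ q : ↑X →ₗ[A] ↑Y, Surjective q →
      InGenT A T X → InGenT A T Y)
    (htors_ext : ∀ X Y Z : ModuleCat.{0} A, ∀ (i : ↑X →ₗ[A] ↑Y) (q : ↑Y →ₗ[A] ↑Z),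
      Injective i → Surjective q → LinearMap.range i = LinearMap.ker q →
      InGenT A T X → InGenT A T Z → InGenT A T Y)
    (hextproj : ∀ X : ModuleCat.{0} A, InGenT A T X → Ext1Vanish A T ↑X)
    (hfaithful : ∀ a : A, (∀ t : T, a • t = 0) → a = 0)
    (hcount : ∃ k : ℕ, HasIndecCount A T k ∧ HasIndecCount A A k) :
    ProjDimLEOne A T ∧ Ext1Vanish A T T ∧
      ∃ (T₁ T₂ : ModuleCat.{0} A) (i : A →ₗ[A] ↑T₁) (q : ↑T₁ →ₗ[A] ↑T₂),
        InAdd A T T₁ ∧ InAdd A T T₂ ∧ Injective i ∧ Surjective q ∧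
          LinearMap.range i = LinearMap.ker q := by
  classical
  have hAN : IsNoetherianRing A := isNoetherian_of_tower K inferInstance
  have hAA : IsArtinianRing A := isArtinian_of_tower K inferInstance
  obtain ⟨k, hTk, hAk⟩ := hcount
  have hT : ExtP A T T := extP_of_ext1Vanish hextproj
  letI : Module K T := Module.compHom T (algebraMap K A)
  haveI : IsScalarTower K A T := IsScalarTower.of_algebraMap_smul fun _ _ => rfl
  haveI : FiniteDimensional K T := Module.Finite.trans A T
  refine ⟨?_, hextproj (ModuleCat.of A T) Gen.self, ?_⟩
  · obtain ⟨n, p, hp⟩ := Module.Finite.exists_fin' A T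
    exact ⟨ModuleCat.of A (Fin n → A), p, inferInstanceAs (Module.Projective A (Fin n → A)), hp,
      ker_projective K hfaithful hT p hp⟩
  · obtain ⟨n, i, hi, hE⟩ := approx (P := A) K hfaithful hT
    refine ⟨ModuleCat.of A (Fin n → T), ModuleCat.of A ((Fin n → T) ⧸ LinearMap.range i), i,
      (LinearMap.range i).mkQ, ?_, ?_, hi, Submodule.mkQ_surjective _,
      (Submodule.ker_mkQ _).symm⟩
    · exact ⟨n, ModuleCat.of A PUnit, ⟨LinearEquiv.prodUnique⟩⟩
    · exact inAdd_of_extP K hfaithful hT hTk hAk _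
        ((Gen.pow n).quot _ (Submodule.mkQ_surjective _)) hE

end
end
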